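/- arXiv:1906.05263 — 6 statements merged into one kernel-verified Lean document; each statement's English description precedes it below -/
import Mathlib

section
/- Let G be a graph on n ≥ 3 vertices with minimum degree δ(G) ≥ n/2. Then either G contains a cycle of length ℓ for every ℓ with 3 ≤ ℓ ≤ n, or n is even and G is isomorphic to the complete bipartite graph K_{n/2, n/2}. -/
/-- The successor of an index on a cycle with `m` vertices. -/
def nextFin {m : ℕ} (j : Fin m) : Fin m :=
  ⟨(j.val + 1) % m, Nat.mod_lt _ (Nat.lt_of_le_of_lt (Nat.zero_le _) j.isLt)⟩

/-- The relation `R` contains a cycle on `m` (distinct) vertices. -/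
def HasCycleLen {W : Type*} (R : W → W → Prop) (m : ℕ) : Prop :=
  ∃ f : Fin m → W, Function.Injective f ∧ ∀ j : Fin m, R (f j) (f (nextFin j))

/-- The adjacency relation on `α ⊕ β` of the bipartite graph with bipartition
`{α, β}` determined by `E : α → β → Prop`. -/
def biAdj {α β : Type*} (E : α → β → Prop) : α ⊕ β → α ⊕ β → Prop
  | Sum.inl a, Sum.inr b => E a b
  | Sum.inr b, Sum.inl a => E a b
  | _, _ => False

/-- The relation `R` contains a path on `m` (distinct) vertices with both ends in `S`. -/
def HasPathEndsIn {W : Type*} (R : W → W → Prop) (m : ℕ) (S : Set W) : Prop :=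
  ∃ f : Fin m → W, Function.Injective f ∧
    (∀ (j : ℕ) (h : j + 1 < m), R (f ⟨j, by omega⟩) (f ⟨j + 1, h⟩)) ∧
    ∀ h : 0 < m, f ⟨0, h⟩ ∈ S ∧ f ⟨m - 1, by omega⟩ ∈ S

/-- The function `v : ℕ → V` runs periodically, with period `n`, through `n` distinct vertices. -/
structure IsCyclicEnum {V : Type*} (n : ℕ) (v : ℕ → V) : Prop where
  periodic : Function.Periodic v n
  inj : ∀ s < n, ∀ t < n, v s = v t → s = t

/-- The function `v : ℤ → V` runs periodically, with period `n`, through a cycle of `G` with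
`n` distinct vertices. -/
structure IsCycleEnum {V : Type*} (G : SimpleGraph V) (n : ℕ) (v : ℤ → V) : Prop where
  periodic : Function.Periodic v (n : ℤ)
  dvd_of_eq : ∀ s t, v s = v t → (n : ℤ) ∣ s - t
  adj : ∀ s, G.Adj (v s) (v (s + 1))

section Dirac

variable {V : Type*} {G : SimpleGraph V} {n : ℕ}

open Classical in
/-- The degree of a vertex, computed along an enumeration of the vertices. -/
theorem ncard_neighborSet_eq_card_filter [Fintype V] (hcard : Fintype.card V = n) {f : ℕ → V}
    (hf : ∀ s < n, ∀ t < n, f s = f t → s = t) (x : V) :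
    (G.neighborSet x).ncard = ((Finset.range n).filter fun t => G.Adj x (f t)).card := by
  have himg : (Finset.range n).image f = Finset.univ := by
    apply Finset.eq_univ_of_card
    rw [Finset.card_image_of_injOn, Finset.card_range, hcard]
    intro s hs t ht h
    exact hf s (by simpa using hs) t (by simpa using ht) h
  have hset : G.neighborSet x = f '' ((Finset.range n).filter fun t => G.Adj x (f t) : Finset ℕ) := by
    ext y
    simp only [SimpleGraph.mem_neighborSet, Finset.coe_filter, Finset.mem_range, Set.mem_image,
      Set.mem_ofPred_eq]
    constructor
    · intro h
      have hy : y ∈ (Finset.range n).image f := himg ▸ Finset.mem_univ y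
      obtain ⟨t, ht, rfl⟩ := Finset.mem_image.1 hy
      exact ⟨t, ⟨by simpa using ht, h⟩, rfl⟩
    · rintro ⟨t, ⟨-, h⟩, rfl⟩
      exact h
  rw [hset, Set.InjOn.ncard_image, Set.ncard_coe_finset]
  intro s hs t ht h
  simp only [Finset.coe_filter, Finset.mem_range, Set.mem_ofPred_eq] at hs ht
  exact hf s hs.1 t ht.1 h

theorem IsCyclicEnum.shift {v : ℕ → V} (hv : IsCyclicEnum n v) (c : ℕ) :
    IsCyclicEnum n fun t => v (t + c) where
  periodic t := by
    have := hv.periodic (t + c)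
    simpa [add_right_comm] using this
  inj s hs t ht h := by
    have hn : 0 < n := by omega
    change v (s + c) = v (t + c) at h
    rw [← hv.periodic.map_mod_nat (s + c), ← hv.periodic.map_mod_nat (t + c)] at h
    have h2 : s + c ≡ t + c [MOD n] := hv.inj _ (Nat.mod_lt _ hn) _ (Nat.mod_lt _ hn) h
    exact (Nat.ModEq.add_right_cancel' c h2).eq_of_lt_of_lt hs ht

theorem exists_isCyclicEnum [Fintype V] (hcard : Fintype.card V = n) (hn : 0 < n) :
    ∃ v : ℕ → V, IsCyclicEnum n v := by
  obtain e := Fintype.equivFinOfCardEq hcard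
  refine ⟨fun t => e.symm ⟨t % n, Nat.mod_lt _ hn⟩, fun t => by simp, fun s hs t ht h => ?_⟩
  simpa [Nat.mod_eq_of_lt hs, Nat.mod_eq_of_lt ht] using h

/-- Reverse the first `a` entries of an enumeration with period `n`. -/
def reverseInitial (n a : ℕ) (w : ℕ → V) (t : ℕ) : V :=
  if t % n < a then w (a - 1 - t % n) else w (t % n)

theorem IsCyclicEnum.reverseInitial {w : ℕ → V} (hw : IsCyclicEnum n w) {a : ℕ} (ha : a < n) :
    IsCyclicEnum n (reverseInitial n a w) where
  periodic t := by simp [_root_.reverseInitial]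
  inj s hs t ht h := by
    simp only [_root_.reverseInitial, Nat.mod_eq_of_lt hs, Nat.mod_eq_of_lt ht] at h
    split_ifs at h with h1 h2 h2 <;> have := hw.inj _ (by omega) _ (by omega) h <;> omega

open Classical in
/-- If the enumeration misses the adjacency between its last and first vertex, reversing a
suitable initial segment increases the number of consecutive adjacent pairs. -/
theorem IsCyclicEnum.exists_card_lt_of_not_adj [Fintype V] (hcard : Fintype.card V = n)
    (hdeg : ∀ v : V, n ≤ 2 * (G.neighborSet v).ncard) {w : ℕ → V} (hw : IsCyclicEnum n w)
    (hn : 0 < n) (hna : ¬ G.Adj (w (n - 1)) (w n)) :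
    ∃ u : ℕ → V, IsCyclicEnum n u ∧
      ((Finset.range n).filter fun t => G.Adj (w t) (w (t + 1))).card <
        ((Finset.range n).filter fun t => G.Adj (u t) (u (t + 1))).card := by
  have hw0 : w n = w 0 := by simpa using hw.periodic 0
  rw [hw0] at hna
  set T := (Finset.range n).filter fun t => G.Adj (w 0) (w t) with hT
  set S := (Finset.range n).filter fun t => G.Adj (w (n - 1)) (w (t + (n - 1))) with hS
  have hTc : (G.neighborSet (w 0)).ncard = T.card :=
    ncard_neighborSet_eq_card_filter hcard hw.inj _
  have hSc : (G.neighborSet (w (n - 1))).ncard = S.card :=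
    ncard_neighborSet_eq_card_filter hcard (hw.shift (n - 1)).inj _
  have hsub : S ∪ T ⊆ Finset.Ico 1 n := by
    intro t ht
    rcases Nat.eq_zero_or_pos t with rfl | h0
    · simp [hS, hT] at ht
    · simp only [hS, hT, Finset.mem_union, Finset.mem_filter, Finset.mem_range] at ht
      simp only [Finset.mem_Ico]
      omega
  have hle := Finset.card_le_card hsub
  have hui := Finset.card_union_add_card_inter S T
  have h1 := hdeg (w 0)
  have h2 := hdeg (w (n - 1))
  rw [Nat.card_Ico] at hle
  obtain ⟨a, ha⟩ : (S ∩ T).Nonempty := Finset.card_pos.1 (by omega)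
  have ha1 := Finset.mem_Ico.1 (hsub (Finset.inter_subset_union ha))
  simp only [hS, hT, Finset.mem_inter, Finset.mem_filter, Finset.mem_range] at ha
  obtain ⟨⟨-, hS'⟩, -, hT'⟩ := ha
  rw [show a + (n - 1) = (a - 1) + n by omega, hw.periodic] at hS'
  have ha2 : a ≠ 1 := by rintro rfl; exact hna hS'
  have ha3 : a ≠ n - 1 := by rintro rfl; exact hna hT'.symm
  have hu : ∀ t < n, _root_.reverseInitial n a w t = if t < a then w (a - 1 - t) else w t :=
    fun t ht => by simp [_root_.reverseInitial, Nat.mod_eq_of_lt ht]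
  have hun : _root_.reverseInitial n a w n = w (a - 1) := by
    simp [_root_.reverseInitial, show 0 < a by omega]
  refine ⟨_, hw.reverseInitial ha1.2, ?_⟩
  set u := _root_.reverseInitial n a w
  set ψ : ℕ → ℕ := fun t => if t + 2 ≤ a then a - 2 - t else t with hψ
  have hlast : n - 1 ∈ (Finset.range n).filter fun t => G.Adj (u t) (u (t + 1)) := by
    simp only [Finset.mem_filter, Finset.mem_range]
    refine ⟨by omega, ?_⟩
    rw [Nat.sub_add_cancel hn, hun, hu _ (by omega), if_neg (by omega)]
    exact hS'
  have himg : ((Finset.range n).filter fun t => G.Adj (w t) (w (t + 1))).image ψ ⊆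
      ((Finset.range n).filter fun t => G.Adj (u t) (u (t + 1))).erase (n - 1) := by
    intro s hs
    obtain ⟨t, ht, rfl⟩ := Finset.mem_image.1 hs
    simp only [Finset.mem_filter, Finset.mem_range] at ht
    obtain ⟨ht, hadj⟩ := ht
    have htn : t ≠ n - 1 := by
      rintro rfl
      rw [Nat.sub_add_cancel hn, hw0] at hadj
      exact hna hadj
    have hψt : ψ t = if t + 2 ≤ a then a - 2 - t else t := rfl
    simp only [Finset.mem_erase, Finset.mem_filter, Finset.mem_range]
    by_cases h : t + 2 ≤ a
    · rw [hψt, if_pos h]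
      refine ⟨by omega, by omega, ?_⟩
      rw [hu _ (by omega), hu _ (by omega), if_pos (by omega), if_pos (by omega),
        show a - 1 - (a - 2 - t) = t + 1 by omega, show a - 1 - (a - 2 - t + 1) = t by omega]
      exact hadj.symm
    · rw [hψt, if_neg h]
      refine ⟨by omega, by omega, ?_⟩
      rw [hu _ (by omega), hu _ (by omega), if_neg (by omega : ¬ t + 1 < a)]
      by_cases h' : t < a
      · rw [if_pos h', show a - 1 - t = 0 by omega, show t + 1 = a by omega]
        exact hT'
      · rw [if_neg h']
        exact hadj
  have hinj : Function.Injective ψ := by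
    intro s t h
    simp only [hψ] at h
    split_ifs at h <;> omega
  have := Finset.card_le_card himg
  rw [Finset.card_image_of_injective _ hinj, Finset.card_erase_of_mem hlast] at this
  have := Finset.card_pos.2 ⟨_, hlast⟩
  omega

open Classical in
theorem exists_isCyclicEnum_card_ge [Fintype V] (hcard : Fintype.card V = n) (hn : 0 < n)
    (hdeg : ∀ v : V, n ≤ 2 * (G.neighborSet v).ncard) (d : ℕ) (hd : d ≤ n) :
    ∃ v : ℕ → V, IsCyclicEnum n v ∧
      d ≤ ((Finset.range n).filter fun t => G.Adj (v t) (v (t + 1))).card := by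
  induction d with
  | zero =>
    obtain ⟨v, hv⟩ := exists_isCyclicEnum hcard hn
    exact ⟨v, hv, Nat.zero_le _⟩
  | succ d ih =>
    obtain ⟨v, hv, hle⟩ := ih (by omega)
    by_cases hall : ∀ t ∈ Finset.range n, G.Adj (v t) (v (t + 1))
    · refine ⟨v, hv, ?_⟩
      rw [Finset.filter_true_of_mem hall, Finset.card_range]
      exact hd
    push Not at hall
    obtain ⟨i, -, hi⟩ := hall
    have hper : Function.Periodic (fun t => G.Adj (v t) (v (t + 1))) n := fun t => by
      simp only [add_right_comm t n 1, hv.periodic t, hv.periodic (t + 1)]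
    have hcount : ((Finset.range n).filter fun t =>
        G.Adj (v (t + (i + 1))) (v (t + 1 + (i + 1)))).card =
        ((Finset.range n).filter fun t => G.Adj (v t) (v (t + 1))).card := by
      have h := Nat.filter_Ico_card_eq_of_periodic (i + 1) n _ hper
      rw [Nat.count_eq_card_filter_range] at h
      rw [← h]
      refine Finset.card_bij (fun t _ => t + (i + 1)) ?_ (by simp) ?_
      · intro t ht
        simp only [Finset.mem_filter, Finset.mem_range, Finset.mem_Ico] at ht ⊢
        refine ⟨by omega, ?_⟩
        rw [add_right_comm]
        exact ht.2
      · intro t ht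
        simp only [Finset.mem_filter, Finset.mem_Ico] at ht
        refine ⟨t - (i + 1), ?_, by omega⟩
        simp only [Finset.mem_filter, Finset.mem_range]
        rw [add_right_comm, Nat.sub_add_cancel ht.1.1]
        exact ⟨by omega, ht.2⟩
    obtain ⟨u, hu, hlt⟩ := (hv.shift (i + 1)).exists_card_lt_of_not_adj hcard hdeg hn (by
      rwa [show n - 1 + (i + 1) = i + n by omega, show n + (i + 1) = (i + 1) + n by omega,
        hv.periodic, hv.periodic])
    refine ⟨u, hu, ?_⟩
    rw [hcount] at hlt
    omega

/-- Dirac's theorem. -/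
theorem exists_isCycleEnum [Fintype V] (hcard : Fintype.card V = n) (hn : 0 < n)
    (hdeg : ∀ v : V, n ≤ 2 * (G.neighborSet v).ncard) :
    ∃ v : ℤ → V, IsCycleEnum G n v := by
  classical
  obtain ⟨u, hu, hle⟩ := exists_isCyclicEnum_card_ge hcard hn hdeg n le_rfl
  have hall : ∀ t < n, G.Adj (u t) (u (t + 1)) := by
    have := Finset.eq_of_subset_of_card_le (Finset.filter_subset _ _)
      (by rw [Finset.card_range]; exact hle)
    intro t ht
    have hmem := Finset.mem_range.2 ht
    rw [← this] at hmem
    exact (Finset.mem_filter.1 hmem).2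
  have hnz : (0 : ℤ) < n := by exact_mod_cast hn
  have hlt : ∀ z : ℤ, (z % n).toNat < n := fun z => by
    have := Int.emod_lt_of_pos z hnz
    omega
  refine ⟨fun z => u (z % n).toNat, fun z => by simp, fun s t h => ?_, fun s => ?_⟩
  · have h1 := hu.inj _ (hlt s) _ (hlt t) h
    have h2 := Int.emod_nonneg s hnz.ne'
    have h3 := Int.emod_nonneg t hnz.ne'
    exact Int.ModEq.dvd (show t % n = s % n by omega)
  · have h2 := Int.emod_nonneg s hnz.ne'
    have h3 := Int.emod_nonneg (s + 1) hnz.ne'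
    have key : ((s + 1) % n).toNat = ((s % n).toNat + 1) % n := by
      zify
      rw [Int.toNat_of_nonneg h2, Int.toNat_of_nonneg h3, Int.emod_add_emod]
    simp only [key, hu.periodic.map_mod_nat]
    exact hall _ (hlt s)

end Dirac

theorem HasCycleLen.of_nat {W : Type*} {R : W → W → Prop} {m : ℕ} (g : ℕ → W)
    (hinj : ∀ s < m, ∀ t < m, g s = g t → s = t)
    (hstep : ∀ s, s + 1 < m → R (g s) (g (s + 1))) (hclose : R (g (m - 1)) (g 0)) :
    HasCycleLen R m := by
  refine ⟨fun j => g j, fun s t h => Fin.ext (hinj s s.2 t t.2 h), fun j => ?_⟩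
  change R (g j) (g ((j + 1) % m))
  have hj := j.2
  rcases Nat.lt_or_ge (j + 1) m with h | h
  · rw [Nat.mod_eq_of_lt h]
    exact hstep _ h
  · have hjm : j.val = m - 1 := by omega
    rw [show j.val + 1 = m by omega, Nat.mod_self, hjm]
    exact hclose

namespace IsCycleEnum

variable {V : Type*} {G : SimpleGraph V} {n ℓ : ℕ} {v : ℤ → V}

theorem eq_of_apply_eq (hv : IsCycleEnum G n v) (c : ℤ) {s t : ℤ} (hs : c ≤ s) (hs' : s < c + n)
    (ht : c ≤ t) (ht' : t < c + n) (h : v s = v t) : s = t := by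
  have := Int.eq_zero_of_abs_lt_dvd (hv.dvd_of_eq s t h) (abs_lt.2 ⟨by omega, by omega⟩)
  omega

theorem adj_of_eq_add_one (hv : IsCycleEnum G n v) {s t : ℤ} (h : t = s + 1) :
    G.Adj (v s) (v t) :=
  h ▸ hv.adj s

/-- Two disjoint arcs joined by chords between their initial and between their final vertices. -/
theorem hasCycleLen_of_adj_parallel (hv : IsCycleEnum G n v) {p q r s : ℤ} (hpq : p ≤ q)
    (hqr : q < r) (hrs : r ≤ s) (hsp : s < p + n) (hℓ : q - p + (s - r) + 2 = ℓ)
    (h₁ : G.Adj (v p) (v r)) (h₂ : G.Adj (v q) (v s)) : HasCycleLen G.Adj ℓ := by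
  refine .of_nat (fun t : ℕ => v (if (t : ℤ) ≤ q - p then p + t else s - (t - (q - p) - 1)))
    ?_ ?_ ?_
  · intro a ha b hb h
    have := hv.eq_of_apply_eq p (by split_ifs <;> omega) (by split_ifs <;> omega)
      (by split_ifs <;> omega) (by split_ifs <;> omega) h
    split_ifs at this <;> omega
  · intro a ha
    push_cast
    split_ifs with h h' h'
    · exact hv.adj_of_eq_add_one (by ring)
    · convert h₂ using 2 <;> omega
    · omega
    · exact (hv.adj_of_eq_add_one (by ring)).symm
  · rw [if_neg (by omega), if_pos (by simpa using hpq)]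
    convert h₁.symm using 2 <;> omega

/-- Two disjoint arcs joined by chords from the final vertex of each to the initial vertex of the
other. -/
theorem hasCycleLen_of_adj_antiparallel (hv : IsCycleEnum G n v) {p q r s : ℤ} (hpq : p ≤ q)
    (hqr : q < r) (hrs : r ≤ s) (hsp : s < p + n) (hℓ : q - p + (s - r) + 2 = ℓ)
    (h₁ : G.Adj (v p) (v s)) (h₂ : G.Adj (v q) (v r)) : HasCycleLen G.Adj ℓ := by
  refine .of_nat (fun t : ℕ => v (if (t : ℤ) ≤ q - p then p + t else r + (t - (q - p) - 1)))
    ?_ ?_ ?_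
  · intro a ha b hb h
    have := hv.eq_of_apply_eq p (by split_ifs <;> omega) (by split_ifs <;> omega)
      (by split_ifs <;> omega) (by split_ifs <;> omega) h
    split_ifs at this <;> omega
  · intro a ha
    push_cast
    split_ifs with h h' h'
    · exact hv.adj_of_eq_add_one (by ring)
    · convert h₂ using 2 <;> omega
    · omega
    · exact hv.adj_of_eq_add_one (by ring)
  · rw [if_neg (by omega), if_pos (by simpa using hpq)]
    convert h₁.symm using 2 <;> omega

theorem hasCycleLen_self (hv : IsCycleEnum G n v) (hn : 3 ≤ n) : HasCycleLen G.Adj n := by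
  refine hv.hasCycleLen_of_adj_antiparallel (p := 0) (q := 0) (r := 1) (s := n - 1) le_rfl
    one_pos (by omega) (by omega) (by omega) ?_ (hv.adj 0)
  have h := hv.adj (n - 1)
  rw [sub_add_cancel, hv.periodic.eq] at h
  exact h.symm

/-- The square of a path has a spanning cycle. -/
theorem hasCycleLen_of_adj_add_two (hv : IsCycleEnum G n v) (hℓ : 3 ≤ ℓ) (hℓn : ℓ ≤ n) (j : ℤ)
    (h : ∀ k : ℕ, G.Adj (v (j + k)) (v (j + k + 2))) : HasCycleLen G.Adj ℓ := by
  refine .of_nat (fun t : ℕ => v (j + (if 2 * t < ℓ then 2 * t else 2 * (ℓ - 1 - t) + 1 : ℕ)))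
    ?_ ?_ ?_
  · intro a ha b hb h
    have := hv.eq_of_apply_eq j (by omega) (by split_ifs <;> omega)
      (by omega) (by split_ifs <;> omega) h
    split_ifs at this <;> omega
  · intro a ha
    split_ifs with h₁ h₂ h₂
    · convert h (2 * a) using 2
      push_cast
      ring
    · rcases Nat.lt_or_ge (2 * a + 1) ℓ with h₃ | h₃
      · exact hv.adj_of_eq_add_one (by omega)
      · exact (hv.adj_of_eq_add_one (by omega)).symm
    · omega
    · convert (h (2 * (ℓ - 1 - (a + 1)) + 1)).symm using 2
      omega
  · rw [if_neg (by omega), if_pos (by omega)]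
    exact (hv.adj_of_eq_add_one (by omega)).symm

theorem not_adj_of_adj_of_lt (hv : IsCycleEnum G n v) (hℓn : ℓ < n)
    (hno : ¬ HasCycleLen G.Adj ℓ) {j a : ℤ} (ha : 2 ≤ a) (ha' : a < ℓ)
    (h : G.Adj (v j) (v (j + a))) : ¬ G.Adj (v (j + 1)) (v (j + 1 + (a + n - ℓ))) := by
  intro h'
  refine hno (hv.hasCycleLen_of_adj_parallel (q := j + a) (s := j + n) (by omega) (by omega)
    (by omega) (by omega) (by omega) h' ?_)
  rw [hv.periodic]
  exact h.symm

theorem not_adj_of_adj_of_ge (hv : IsCycleEnum G n v) (hℓ : 3 ≤ ℓ)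
    (hno : ¬ HasCycleLen G.Adj ℓ) {j a : ℤ} (ha : ℓ ≤ a) (ha' : a < n)
    (h : G.Adj (v j) (v (j + a))) : ¬ G.Adj (v (j + 1)) (v (j + 1 + (a + 2 - ℓ))) := by
  intro h'
  exact hno (hv.hasCycleLen_of_adj_antiparallel (by omega) (by omega)
    (by omega) (by omega) (by omega) h h')

section NoCycle

variable (hv : IsCycleEnum G n v) (hℓ : 3 ≤ ℓ) (hℓn : ℓ < n) (hno : ¬ HasCycleLen G.Adj ℓ)
  [Fintype V] (hcard : Fintype.card V = n)
  (hdeg : ∀ v : V, n ≤ 2 * (G.neighborSet v).ncard)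
include hv hℓ hℓn hno hcard hdeg

/-- Consecutive vertices of the cycle have degree sum `n`, and every pair of possible chords at
them that would close up to a cycle of length `ℓ` contains an edge. -/
theorem ncard_add_ncard_eq_and_adj (j : ℤ) :
    (G.neighborSet (v j)).ncard + (G.neighborSet (v (j + 1))).ncard = n ∧
      ∀ a : ℕ, 2 ≤ a → a < n → ¬ G.Adj (v j) (v (j + a)) →
        G.Adj (v (j + 1)) (v (j + 1 + (if a < ℓ then a + n - ℓ else a + 2 - ℓ : ℕ))) := by
  classical
  have hdegree : ∀ i : ℤ, (G.neighborSet (v i)).ncard =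
      ((Finset.range n).filter fun t : ℕ => G.Adj (v i) (v (i + t))).card := fun i =>
    ncard_neighborSet_eq_card_filter hcard (f := fun t : ℕ => v (i + t)) (fun s hs t ht h => by
      have := hv.eq_of_apply_eq i (by omega) (by omega) (by omega) (by omega) h
      omega) _
  set N : ℤ → Finset ℕ := fun i => (Finset.range n).filter fun t : ℕ => G.Adj (v i) (v (i + t))
    with hN
  have hmem : ∀ (i : ℤ) (t : ℕ), t ∈ N i ↔ t < n ∧ G.Adj (v i) (v (i + t)) := fun i t => by
    simp [hN]
  have hone : ∀ i, 1 ∈ N i := fun i => (hmem i 1).2 ⟨by omega, by exact_mod_cast hv.adj i⟩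
  have hsub : ∀ i, (N i).erase 1 ⊆ Finset.Ico 2 n := by
    intro i t ht
    rw [Finset.mem_erase, hmem] at ht
    have h0 : t ≠ 0 := by
      rintro rfl
      simp at ht
    rw [Finset.mem_Ico]
    omega
  have herase : ∀ i, ((N i).erase 1).card + 1 = (G.neighborSet (v i)).ncard := fun i => by
    rw [hdegree, Finset.card_erase_add_one (hone i)]
  set φ : ℕ → ℕ := fun a => if a < ℓ then a + n - ℓ else a + 2 - ℓ with hφ
  have hφmaps : ∀ a ∈ Finset.Ico 2 n, φ a ∈ Finset.Ico 2 n := by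
    intro a ha
    rw [Finset.mem_Ico] at ha ⊢
    simp only [hφ]
    split_ifs <;> omega
  have hφinj : Set.InjOn φ (Finset.Ico 2 n) := by
    intro a ha b hb h
    rw [Finset.mem_coe, Finset.mem_Ico] at ha hb
    simp only [hφ] at h
    split_ifs at h <;> omega
  have hdisj : Disjoint (((N j).erase 1).image φ) ((N (j + 1)).erase 1) := by
    rw [Finset.disjoint_left]
    intro b hb hb'
    obtain ⟨a, ha, rfl⟩ := Finset.mem_image.1 hb
    have ha2 := Finset.mem_Ico.1 (hsub j ha)
    have h := ((hmem _ _).1 (Finset.mem_of_mem_erase ha)).2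
    have h' := ((hmem _ _).1 (Finset.mem_of_mem_erase hb')).2
    simp only [hφ] at h'
    split_ifs at h' with hlt
    · refine hv.not_adj_of_adj_of_lt hℓn hno (by omega) (by omega) h ?_
      convert h' using 3
      omega
    · refine hv.not_adj_of_adj_of_ge hℓ hno (by omega) (by omega) h ?_
      convert h' using 3
      omega
  have hunion : ((N j).erase 1).image φ ∪ (N (j + 1)).erase 1 ⊆ Finset.Ico 2 n := by
    refine Finset.union_subset (fun b hb => ?_) (hsub _)
    obtain ⟨a, ha, rfl⟩ := Finset.mem_image.1 hb
    exact hφmaps a (hsub j ha)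
  have hcardu := Finset.card_union_of_disjoint hdisj
  rw [Finset.card_image_of_injOn (hφinj.mono (by exact_mod_cast hsub j))] at hcardu
  have hle := Finset.card_le_card hunion
  rw [Nat.card_Ico] at hle
  have h₁ := herase j
  have h₂ := herase (j + 1)
  have h₃ := hdeg (v j)
  have h₄ := hdeg (v (j + 1))
  refine ⟨by omega, fun a ha ha' hna => ?_⟩
  have heq := Finset.eq_of_subset_of_card_le hunion (by rw [Nat.card_Ico]; omega)
  have haI : a ∈ Finset.Ico 2 n := Finset.mem_Ico.2 ⟨ha, ha'⟩
  have hφa := hφmaps a haI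
  rw [← heq, Finset.mem_union] at hφa
  rcases hφa with h | h
  · obtain ⟨b, hb, hba⟩ := Finset.mem_image.1 h
    rw [hφinj (hsub j hb) haI hba] at hb
    exact absurd ((hmem _ _).1 (Finset.mem_of_mem_erase hb)).2 hna
  · exact ((hmem _ _).1 (Finset.mem_of_mem_erase h)).2

theorem adj_of_not_adj_of_lt {j a : ℤ} (ha : 2 ≤ a) (ha' : a < ℓ)
    (h : ¬ G.Adj (v (j + 1)) (v (j + 1 + (a + n - ℓ)))) : G.Adj (v j) (v (j + a)) := by
  lift a to ℕ using by omega
  by_contra hna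
  have h' := (hv.ncard_add_ncard_eq_and_adj hℓ hℓn hno hcard hdeg j).2 a (by omega) (by omega) hna
  rw [if_pos (by omega)] at h'
  refine h ?_
  convert h' using 3
  omega

theorem adj_of_not_adj_of_ge {j a : ℤ} (ha : ℓ ≤ a) (ha' : a < n)
    (h : ¬ G.Adj (v (j + 1)) (v (j + 1 + (a + 2 - ℓ)))) : G.Adj (v j) (v (j + a)) := by
  lift a to ℕ using by omega
  by_contra hna
  have h' := (hv.ncard_add_ncard_eq_and_adj hℓ hℓn hno hcard hdeg j).2 a (by omega) (by omega) hna
  rw [if_neg (by omega)] at h'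
  refine h ?_
  convert h' using 3
  omega

theorem two_mul_ncard_eq (j : ℤ) : 2 * (G.neighborSet (v j)).ncard = n := by
  have := (hv.ncard_add_ncard_eq_and_adj hℓ hℓn hno hcard hdeg j).1
  have := hdeg (v j)
  have := hdeg (v (j + 1))
  omega

theorem not_adj_add_two (j : ℤ) : ¬ G.Adj (v j) (v (j + 2)) := by
  intro h
  have hstep : ∀ i, G.Adj (v i) (v (i + 2)) → G.Adj (v (i + 1)) (v (i + 1 + 2)) := by
    intro i hi
    by_contra hna
    have hchord : G.Adj (v i) (v (i + ℓ)) :=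
      hv.adj_of_not_adj_of_ge hℓ hℓn hno hcard hdeg le_rfl (by omega) (by
        rwa [show (ℓ : ℤ) + 2 - ℓ = 2 by ring])
    exact hno (hv.hasCycleLen_of_adj_antiparallel le_rfl (by omega) (by omega) (by omega)
      (by omega) hchord hi)
  refine hno (hv.hasCycleLen_of_adj_add_two hℓ hℓn.le j fun k => ?_)
  induction k with
  | zero => simpa using h
  | succ k ih =>
    have := hstep _ ih
    push_cast
    rwa [← add_assoc]

theorem not_adj_add_two_mul (k : ℕ) (hk : 1 ≤ k) (hkn : 2 * k < n) (j : ℤ) :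
    ¬ G.Adj (v j) (v (j + 2 * k)) := by
  induction k using Nat.strong_induction_on generalizing j with
  | _ k ih =>
  intro h
  have heven := hv.two_mul_ncard_eq hℓ hℓn hno hcard hdeg j
  rcases Nat.lt_or_ge n (4 * k) with hlarge | hsmall
  · obtain ⟨m, hm⟩ : ∃ m, 2 * m = n := ⟨_, heven⟩
    refine ih (m - k) (by omega) (by omega) (by omega) (j + 2 * k) ?_
    rw [show j + 2 * k + 2 * ((m - k : ℕ) : ℤ) = j + n by omega, hv.periodic]
    exact h.symm
  rcases Nat.lt_or_ge k 2 with h1 | h2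
  · obtain rfl : k = 1 := by omega
    exact hv.not_adj_add_two hℓ hℓn hno hcard hdeg j (by simpa using h)
  have ihk := ih (k - 1) (by omega) (by omega) (by omega)
  rcases Nat.lt_or_ge ℓ (2 * k) with hkℓ | hkℓ
  · have hchord : G.Adj (v (j - ℓ + 3)) (v (j - ℓ + 3 + (ℓ + 2 * k - 4))) := by
      refine hv.adj_of_not_adj_of_ge hℓ hℓn hno hcard hdeg (by omega) (by omega) ?_
      convert ihk (j - ℓ + 3 + 1) using 4
      omega
    refine hno (hv.hasCycleLen_of_adj_parallel (p := j - ℓ + 3) (q := j) (s := j + 2 * k)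
      (by omega) (by omega) (by omega) (by omega) (by omega) hchord h)
  · have hchord : G.Adj (v (j + 2 * k - 2)) (v (j + 2 * k - 2 + (ℓ - 2 * k + 2))) := by
      refine hv.adj_of_not_adj_of_lt hℓ hℓn hno hcard hdeg (by omega) (by omega) fun hadj => ?_
      rw [show j + 2 * (k : ℤ) - 2 + 1 + (ℓ - 2 * k + 2 + n - ℓ) = j + 1 + n by ring,
        hv.periodic] at hadj
      refine ihk (j + 1) ?_
      convert hadj.symm using 2
      omega
    exact hno (hv.hasCycleLen_of_adj_parallel (q := j + 2 * k - 2) (by omega) (by omega) (by omega)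
      (by omega) (by omega) h hchord)

theorem not_adj_of_even {s t : ℤ} (h : Even (t - s)) (hst : |t - s| < n) :
    ¬ G.Adj (v s) (v t) := by
  wlog hle : s ≤ t generalizing s t
  · rw [G.adj_comm]
    exact this (by rwa [← neg_sub, even_neg]) (by rwa [abs_sub_comm]) (by omega)
  obtain ⟨k, hk⟩ := h
  rw [abs_lt] at hst
  lift k to ℕ using by omega
  obtain rfl : t = s + 2 * k := by omega
  rcases Nat.eq_zero_or_pos k with rfl | hpos
  · simp
  · exact hv.not_adj_add_two_mul hℓ hℓn hno hcard hdeg k hpos (by omega) s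

theorem adj_of_odd {s t : ℤ} (h : Odd (t - s)) (hst : |t - s| < n) : G.Adj (v s) (v t) := by
  classical
  wlog hle : s ≤ t generalizing s t
  · exact (this (by rwa [← neg_sub, odd_neg]) (by rwa [abs_sub_comm]) (by omega)).symm
  obtain ⟨k, hk⟩ := h
  rw [abs_lt] at hst
  lift k to ℕ using by omega
  set m := (G.neighborSet (v s)).ncard with hm
  have hmn : 2 * m = n := hv.two_mul_ncard_eq hℓ hℓn hno hcard hdeg s
  rw [ncard_neighborSet_eq_card_filter hcard (f := fun a : ℕ => v (s + a)) (fun a ha b hb hab => by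
    have := hv.eq_of_apply_eq s (by omega) (by omega) (by omega) (by omega) hab
    omega)] at hm
  have hsub : ((Finset.range n).filter fun a : ℕ => G.Adj (v s) (v (s + a))) ⊆
      (Finset.range m).image fun i => 2 * i + 1 := by
    intro a ha
    rw [Finset.mem_filter, Finset.mem_range] at ha
    rcases Nat.even_or_odd' a with ⟨i, rfl | rfl⟩
    · refine absurd ha.2 (hv.not_adj_of_even hℓ hℓn hno hcard hdeg ?_ ?_)
      · simp
      · rw [abs_lt]
        omega
    · exact Finset.mem_image.2 ⟨i, Finset.mem_range.2 (by omega), rfl⟩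
  have heq := Finset.eq_of_subset_of_card_le hsub
    (Finset.card_image_le.trans (by rw [Finset.card_range]; exact hm.le))
  have hmem : 2 * k + 1 ∈ (Finset.range m).image fun i => 2 * i + 1 :=
    Finset.mem_image.2 ⟨k, Finset.mem_range.2 (by omega), rfl⟩
  rw [← heq, Finset.mem_filter] at hmem
  convert hmem.2 using 2
  omega

theorem exists_iso_completeBipartiteGraph :
    ∃ m : ℕ, n = 2 * m ∧ Nonempty (G ≃g completeBipartiteGraph (Fin m) (Fin m)) := by
  obtain ⟨m, hm⟩ : ∃ m, n = 2 * m := ⟨_, (hv.two_mul_ncard_eq hℓ hℓn hno hcard hdeg 0).symm⟩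
  refine ⟨m, hm, ?_⟩
  set pos : Fin m ⊕ Fin m → ℤ := Sum.elim (fun i => 2 * (i : ℕ)) (fun i => 2 * (i : ℕ) + 1)
    with hpos
  have hbound : ∀ x, 0 ≤ pos x ∧ pos x < n := by
    rintro (i | i) <;> simp only [hpos, Sum.elim_inl, Sum.elim_inr] <;> omega
  have hinj : Function.Injective fun x => v (pos x) := by
    intro x y h
    have := hv.eq_of_apply_eq 0 (hbound x).1 (by simpa using (hbound x).2) (hbound y).1
      (by simpa using (hbound y).2) h
    rcases x with i | i <;> rcases y with k | k <;>
      simp only [hpos, Sum.elim_inl, Sum.elim_inr, Sum.inl.injEq, Sum.inr.injEq] at this ⊢ <;> omega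
  have hbij := (Fintype.bijective_iff_injective_and_card _).2
    ⟨hinj, by rw [hcard, Fintype.card_sum, Fintype.card_fin]; omega⟩
  have habs : ∀ x y, |pos y - pos x| < n := fun x y => by
    have := hbound x
    have := hbound y
    rw [abs_lt]
    omega
  have hadj : ∀ x y, G.Adj (v (pos x)) (v (pos y)) ↔ Odd (pos y - pos x) := fun x y =>
    ⟨fun h => Int.not_even_iff_odd.1 fun he =>
      hv.not_adj_of_even hℓ hℓn hno hcard hdeg he (habs x y) h,
      fun h => hv.adj_of_odd hℓ hℓn hno hcard hdeg h (habs x y)⟩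
  refine ⟨RelIso.symm ⟨Equiv.ofBijective _ hbij, fun {x y} => ?_⟩⟩
  simp only [Equiv.ofBijective_apply, hadj, completeBipartiteGraph_adj]
  rcases x with i | i <;> rcases y with k | k <;> simp [hpos, Int.odd_iff]

end NoCycle

end IsCycleEnum

/-- Bondy's theorem: if $G$ is a graph on $n ≥ 3$ vertices with minimum degree at
least $n/2$, then either $G$ is pancyclic (has a cycle of every length $3 ≤ ℓ ≤ n$)
or $n$ is even and $G$ is isomorphic to $K_{n/2,n/2}$. -/
theorem bondy_pancyclic {V : Type*} [Fintype V] (G : SimpleGraph V) (n : ℕ)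
    (hn : 3 ≤ n) (hcard : Fintype.card V = n)
    (hdeg : ∀ v : V, n ≤ 2 * (G.neighborSet v).ncard) :
    (∀ ℓ : ℕ, 3 ≤ ℓ → ℓ ≤ n → HasCycleLen G.Adj ℓ) ∨
      (∃ m : ℕ, n = 2 * m ∧
        Nonempty (G ≃g completeBipartiteGraph (Fin m) (Fin m))) := by
  by_contra! h
  obtain ⟨⟨ℓ, hℓ, hℓn, hno⟩, hiso⟩ := h
  obtain ⟨v, hv⟩ := exists_isCycleEnum hcard (by omega) hdeg
  have hne : ℓ ≠ n := by
    rintro rfl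
    exact hno (hv.hasCycleLen_self hℓ)
  obtain ⟨m, hm, ⟨e⟩⟩ :=
    hv.exists_iso_completeBipartiteGraph hℓ (by omega) hno hcard hdeg
  exact (hiso m hm).false e
end

section
/- Let G be a bipartite graph with bipartition {M, N} such that |M| ≥ 2, |N| ≥ 4 and δ(M) ≥ (|N| + 1)/2. Then either G has a cycle of length 2ℓ for every ℓ with 2 ≤ ℓ ≤ min{|M|, δ(M) − 1}, or the following holds: Δ(M) = (|N| + 1)/2, and there are nonempty pairwise disjoint sets M_1, M_2, N_1, N_2, N_3 with M = M_1 ∪ M_2 and N = N_1 ∪ N_2 ∪ N_3, |N_3| = 1, |N_1| = |N_2|, such that for each i ∈ {1,2}, every vertex of M_i is adjacent to every vertex of N_i ∪ N_3 and to no vertex of N_{3−i}. -/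
/-- The vertices `a 0, b 0, a 1, b 1, …` run periodically around a cycle of length `2 * m`
(a single edge traversed back and forth if `m = 1`). -/
structure IsBiCycle {α β : Type*} (E : α → β → Prop) (m : ℕ) (a : ℕ → α) (b : ℕ → β) : Prop where
  left_eq_iff : ∀ i j, a i = a j ↔ i ≡ j [MOD m]
  right_eq_iff : ∀ i j, b i = b j ↔ i ≡ j [MOD m]
  adj : ∀ i, E (a i) (b i)
  adj_succ : ∀ i, E (a (i + 1)) (b i)

/-- There is a cycle meeting the left side in `m` vertices. -/
def HasBiCycle {α β : Type*} (E : α → β → Prop) (m : ℕ) : Prop :=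
  ∃ a b, IsBiCycle E m a b

section

variable {α β : Type*} {E : α → β → Prop} {m : ℕ} {a : ℕ → α} {b : ℕ → β}

theorem apply_mod_eq_iff {γ : Type*} {f : ℕ → γ} (hm : 0 < m)
    (hf : ∀ i j, i < j → j < m → f i ≠ f j) (i j : ℕ) :
    f (i % m) = f (j % m) ↔ i ≡ j [MOD m] := by
  refine ⟨fun he => ?_, fun he => by rw [he]⟩
  have h1 := Nat.mod_lt i hm
  have h2 := Nat.mod_lt j hm
  rcases lt_trichotomy (i % m) (j % m) with hlt | heq | hgt
  · exact absurd he (hf _ _ hlt h2)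
  · exact heq
  · exact absurd he.symm (hf _ _ hgt h1)

theorem HasBiCycle.of_finite (hm : 0 < m)
    (ha : ∀ i j, i < j → j < m → a i ≠ a j) (hb : ∀ i j, i < j → j < m → b i ≠ b j)
    (h : ∀ i < m, E (a i) (b i)) (h' : ∀ i, i + 1 < m → E (a (i + 1)) (b i))
    (hl : E (a 0) (b (m - 1))) : HasBiCycle E m := by
  refine ⟨fun i => a (i % m), fun i => b (i % m), apply_mod_eq_iff hm ha, apply_mod_eq_iff hm hb,
    fun i => h _ (Nat.mod_lt i hm), fun i => ?_⟩
  have h1 := Nat.mod_lt i hm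
  by_cases hlt : i % m + 1 < m
  · have : (i + 1) % m = i % m + 1 := by
      rw [Nat.add_mod, Nat.mod_eq_of_lt (by omega : 1 < m), Nat.mod_eq_of_lt hlt]
    simp only [this]
    exact h' _ hlt
  · have h2 : i % m = m - 1 := by omega
    have : (i + 1) % m = 0 := by
      rw [← Nat.mod_add_mod, h2, Nat.sub_add_cancel hm, Nat.mod_self]
    simp only [this, h2]
    exact hl

namespace IsBiCycle

theorem rotate (h : IsBiCycle E m a b) (r : ℕ) :
    IsBiCycle E m (fun i => a (r + i)) (fun i => b (r + i)) where
  left_eq_iff _ _ := (h.left_eq_iff _ _).trans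
    ⟨fun e => Nat.ModEq.add_left_cancel' r e, fun e => e.add_left r⟩
  right_eq_iff _ _ := (h.right_eq_iff _ _).trans
    ⟨fun e => Nat.ModEq.add_left_cancel' r e, fun e => e.add_left r⟩
  adj _ := h.adj _
  adj_succ i := h.adj_succ (r + i)

theorem left_ne (h : IsBiCycle E m a b) {i j : ℕ} (hij : i < j) (hj : j < i + m) :
    a i ≠ a j := by
  rw [Ne, h.left_eq_iff, Nat.modEq_iff_dvd' hij.le]
  intro hd
  have := Nat.le_of_dvd (by omega) hd
  omega

theorem right_ne (h : IsBiCycle E m a b) {i j : ℕ} (hij : i < j) (hj : j < i + m) :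
    b i ≠ b j := by
  rw [Ne, h.right_eq_iff, Nat.modEq_iff_dvd' hij.le]
  intro hd
  have := Nat.le_of_dvd (by omega) hd
  omega

theorem left_period (h : IsBiCycle E m a b) : a m = a 0 :=
  (h.left_eq_iff _ _).2 (by simp [Nat.ModEq])

theorem hasCycleLen (h : IsBiCycle E m a b) : HasCycleLen (biAdj E) (2 * m) := by
  refine ⟨fun t => if t.val % 2 = 0 then Sum.inl (a (t.val / 2)) else Sum.inr (b (t.val / 2)),
    ?_, ?_⟩
  · intro s t hst
    have hs := s.isLt
    have ht := t.isLt
    have hne : ∀ i j, i < m → j < m → a i = a j → i = j := by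
      intro i j hi hj he
      rcases lt_trichotomy i j with hl | hl | hl
      · exact absurd he (h.left_ne hl (by omega))
      · exact hl
      · exact absurd he.symm (h.left_ne hl (by omega))
    have hne' : ∀ i j, i < m → j < m → b i = b j → i = j := by
      intro i j hi hj he
      rcases lt_trichotomy i j with hl | hl | hl
      · exact absurd he (h.right_ne hl (by omega))
      · exact hl
      · exact absurd he.symm (h.right_ne hl (by omega))
    dsimp only at hst
    apply Fin.ext
    split_ifs at hst with h1 h2 h2
    · have := hne _ _ (by omega) (by omega) (Sum.inl_injective hst)
      omega
    · have := hne' _ _ (by omega) (by omega) (Sum.inr_injective hst)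
      omega
  · intro t
    have ht := t.isLt
    have hv : (nextFin t).val = (t.val + 1) % (2 * m) := rfl
    have hv2 : (nextFin t).val % 2 = (t.val + 1) % 2 := by
      rw [hv, Nat.mod_mul_right_mod]
    by_cases h1 : t.val % 2 = 0
    · have h2 : (t.val + 1) % 2 ≠ 0 := by omega
      have h3 : (nextFin t).val = t.val + 1 := by
        rw [hv, Nat.mod_eq_of_lt (by omega)]
      have h4 : (t.val + 1) / 2 = t.val / 2 := by omega
      simp only [if_pos h1, if_neg h2, h3, h4]
      exact h.adj _
    · have h2 : (nextFin t).val % 2 = 0 := by omega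
      simp only [h1, h2, if_true, if_false]
      have h3 : a ((nextFin t).val / 2) = a (t.val / 2 + 1) := by
        by_cases hlt : t.val + 1 < 2 * m
        · rw [hv, Nat.mod_eq_of_lt hlt]
          congr 1
          omega
        · have e1 : t.val + 1 = 2 * m := by omega
          have e2 : t.val / 2 + 1 = m := by omega
          rw [hv, e1, Nat.mod_self, e2, h.left_period, Nat.zero_div]
      rw [h3]
      exact h.adj_succ _

theorem insert_zero (h : IsBiCycle E m a b) {v : α} (hv : ∀ i, a i ≠ v) {x y : β} (hxy : x ≠ y)
    (hx : ∀ i, 1 ≤ i → i < m → b i ≠ x) (hy : ∀ i, 1 ≤ i → i < m → b i ≠ y)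
    (hvx : E v x) (hvy : E v y) (hax : E (a 1) x) (hay : E (a 0) y) (hm : 1 ≤ m) :
    HasBiCycle E (m + 1) := by
  have hp := h.left_period
  refine HasBiCycle.of_finite (a := fun t => if t = 0 then v else a t)
    (b := fun t => if t = 0 then x else if t < m then b t else y) (by omega) ?_ ?_ ?_ ?_ ?_
  · intro i j hij hj
    split_ifs
    all_goals first
      | omega
      | exact (hv _).symm
      | exact h.left_ne hij (by omega)
  · intro i j hij hj
    split_ifs
    all_goals first
      | omega
      | exact hxy
      | exact (hx _ (by omega) (by omega)).symm
      | exact hy _ (by omega) (by omega)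
      | exact h.right_ne hij (by omega)
  · intro i hi
    split_ifs
    · exact hvx
    · exact h.adj _
    · obtain rfl : i = m := by omega
      rwa [hp]
  · intro i hi
    rw [if_neg (Nat.succ_ne_zero i)]
    split_ifs
    · subst i; exact hax
    · exact h.adj_succ _
    · omega
  · simpa [show m ≠ 0 by omega] using hvy

theorem cross_zero (h : IsBiCycle E m a b) {v : α} (hv : ∀ i, a i ≠ v) {y : β}
    (hy : ∀ i, b i ≠ y) {j : ℕ} (hj : 1 ≤ j) (hjm : j < m)
    (hv0 : E v (b 0)) (hvj : E v (b j)) (h0 : E (a 0) y) (hj' : E (a j) y) :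
    HasBiCycle E (m + 1) := by
  have hp := h.left_period
  refine HasBiCycle.of_finite
    (a := fun t => if t = 0 then v else if t ≤ j then a t else a (m + j + 1 - t))
    (b := fun t => if t < j then b t else if t = j then y else b (m + j - t))
    (by omega) ?_ ?_ ?_ ?_ ?_
  · intro i t hij ht
    split_ifs
    all_goals first
      | omega
      | exact (hv _).symm
      | exact h.left_ne (by omega) (by omega)
      | exact (h.left_ne (by omega) (by omega)).symm
  · intro i t hij ht
    split_ifs
    all_goals first
      | omega
      | exact hy _
      | exact (hy _).symm
      | exact h.right_ne (by omega) (by omega)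
      | exact (h.right_ne (by omega) (by omega)).symm
  · intro i hi
    split_ifs
    all_goals first
      | omega
      | (subst i; assumption)
      | exact h.adj _
      | skip
    rw [show m + j + 1 - i = m + j - i + 1 by omega]
    exact h.adj_succ _
  · intro i hi
    rw [if_neg (Nat.succ_ne_zero i)]
    split_ifs
    all_goals first
      | omega
      | exact h.adj_succ _
      | skip
    · subst i
      rw [show m + j + 1 - (j + 1) = m by omega, hp]
      exact h0
    · rw [show m + j + 1 - (i + 1) = m + j - i by omega]
      exact h.adj _
  · simp only [if_true]
    rw [if_neg (by omega), if_neg (by omega), show m + j - (m + 1 - 1) = j by omega]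
    exact hvj

theorem detour_zero (h : IsBiCycle E m a b) {v : α} (hv : ∀ i, a i ≠ v) {y : β}
    (hy : ∀ i, b i ≠ y) {j : ℕ} (hj : 1 ≤ j) (hjm : j < m)
    (hv0 : E v (b 0)) (hvy : E v y) (hj' : E (a j) y) (h1 : E (a 1) (b j)) :
    HasBiCycle E (m + 1) := by
  have hp := h.left_period
  refine HasBiCycle.of_finite
    (a := fun t => if t = 0 then v else if t ≤ j then a (j + 1 - t) else a t)
    (b := fun t => if t = 0 then y else if t < j then b (j - t) else if t < m then b t else b 0)
    (by omega) ?_ ?_ ?_ ?_ ?_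
  · intro i t hij ht
    split_ifs
    all_goals first
      | omega
      | exact (hv _).symm
      | exact h.left_ne (by omega) (by omega)
      | exact (h.left_ne (by omega) (by omega)).symm
  · intro i t hij ht
    split_ifs
    all_goals first
      | omega
      | exact hy _
      | exact (hy _).symm
      | exact h.right_ne (by omega) (by omega)
      | exact (h.right_ne (by omega) (by omega)).symm
  · intro i hi
    split_ifs
    all_goals first
      | omega
      | assumption
      | exact h.adj _
      | skip
    · rw [show j + 1 - i = j - i + 1 by omega]
      exact h.adj_succ _
    · obtain rfl : i = j := by omega
      rw [show i + 1 - i = 1 by omega]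
      exact h1
    · obtain rfl : i = m := by omega
      rw [hp]
      exact h.adj 0
  · intro i hi
    rw [if_neg (Nat.succ_ne_zero i)]
    split_ifs
    all_goals first
      | omega
      | exact h.adj_succ _
      | skip
    · subst i
      simpa using hj'
    · rw [show j + 1 - (i + 1) = j - i by omega]
      exact h.adj _
  · simp only [if_true]
    rw [if_neg (by omega), if_neg (by omega), if_neg (by omega)]
    exact hv0

theorem replace_one (h : IsBiCycle E m a b) {v w : α} (hv : ∀ i, a i ≠ v) (hw : ∀ i, a i ≠ w)
    (hvw : v ≠ w) {y : β} (hy : ∀ i, b i ≠ y) (hm : 2 ≤ m)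
    (hvy : E v y) (hwy : E w y) (hv0 : E v (b 0)) (hw1 : E w (b 1)) :
    HasBiCycle E (m + 1) := by
  have hp := h.left_period
  refine HasBiCycle.of_finite
    (a := fun t => if t = 0 then v else if t = 1 then w else a t)
    (b := fun t => if t = 0 then y else if t < m then b t else b 0)
    (by omega) ?_ ?_ ?_ ?_ ?_
  · intro i t hij ht
    split_ifs
    all_goals first
      | omega
      | exact hvw
      | exact (hv _).symm
      | exact (hw _).symm
      | exact h.left_ne (by omega) (by omega)
  · intro i t hij ht
    split_ifs
    all_goals first
      | omega
      | exact (hy _).symm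
      | exact h.right_ne (by omega) (by omega)
      | exact (h.right_ne (by omega) (by omega)).symm
  · intro i hi
    split_ifs
    all_goals first
      | omega
      | assumption
      | exact h.adj _
      | (subst i; assumption)
      | skip
    obtain rfl : i = m := by omega
    rw [hp]
    exact h.adj 0
  · intro i hi
    rw [if_neg (Nat.succ_ne_zero i)]
    split_ifs
    all_goals first
      | omega
      | assumption
      | exact h.adj_succ _
  · simp only [if_true]
    rw [if_neg (by omega), if_neg (by omega)]
    exact hv0

end IsBiCycle

end

open Classical in
/-- The neighbourhood of a left vertex. -/
noncomputable def biNbhd {α β : Type*} [Fintype β] (E : α → β → Prop) (a : α) : Finset β :=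
  Finset.univ.filter (E a)

section

variable {α β : Type*} [Fintype β] {E : α → β → Prop}

theorem mem_biNbhd {a : α} {b : β} : b ∈ biNbhd E a ↔ E a b := by
  simp [biNbhd]

theorem ncard_eq_card_biNbhd (a : α) : {b | E a b}.ncard = (biNbhd E a).card := by
  rw [← Set.ncard_coe_finset]
  congr 1
  ext b
  simp [mem_biNbhd]

open Classical in
/-- A cycle through `m` left vertices either extends to one through an additional vertex `v`,
or all its left vertices have the same neighbourhood, which meets that of `v` in one vertex. -/
theorem IsBiCycle.extend_or_nbhd_eq {m k : ℕ} {a : ℕ → α} {b : ℕ → β} (h : IsBiCycle E m a b)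
    {v : α} (hv : ∀ i, a i ≠ v) (hm : 1 ≤ m) (hmk : m + 2 ≤ k)
    (hn : Fintype.card β + 1 ≤ 2 * k) (hk : ∀ u, k ≤ (biNbhd E u).card)
    (hno : ¬ HasBiCycle E (m + 1)) :
    Fintype.card β + 1 = 2 * k ∧ (biNbhd E v).card = k ∧
      ∃ (P : Finset β) (x : β), P.card = k ∧ biNbhd E v ∩ P = {x} ∧ ∀ i, biNbhd E (a i) = P := by
  set N := biNbhd E with hN
  have hNE : ∀ u x, x ∈ N u ↔ E u x := fun u x => mem_biNbhd
  set B := (Finset.range m).image b with hB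
  have hbB : ∀ i, b i ∈ B := fun i => Finset.mem_image.2
    ⟨i % m, Finset.mem_range.2 (Nat.mod_lt _ hm), (h.right_eq_iff _ _).2 (Nat.mod_modEq i m)⟩
  have hinj : Set.InjOn b (Finset.range m) := by
    intro i hi j hj he
    simp only [Finset.coe_range, Set.mem_Iio] at hi hj
    exact ((h.right_eq_iff _ _).1 he).eq_of_lt_of_lt hi hj
  have hBc : B.card = m := by
    rw [hB, Finset.card_image_of_injOn hinj, Finset.card_range]
  set S := N v \ B with hS
  have hyB : ∀ y, y ∉ B → ∀ i, b i ≠ y := fun y hy i e => hy (e ▸ hbB i)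
  have insertion : ∀ i x y, x ≠ y → (x ∈ S ∨ x ∈ N v ∧ x = b i) → (y ∈ S ∨ y ∈ N v ∧ y = b i) →
      x ∈ N (a (i + 1)) → y ∈ N (a i) → False := by
    intro i x y hxy hx hy hax hay
    have aux : ∀ x, (x ∈ S ∨ x ∈ N v ∧ x = b i) →
        (∀ t, 1 ≤ t → t < m → b (i + t) ≠ x) ∧ E v x := by
      rintro x (hx | ⟨hx, rfl⟩)
      · rw [hS, Finset.mem_sdiff] at hx
        exact ⟨fun t _ _ => hyB x hx.2 _, (hNE _ _).1 hx.1⟩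
      · exact ⟨fun t h1 h2 => (h.right_ne (by omega) (by omega)).symm, (hNE _ _).1 hx⟩
    exact hno ((h.rotate i).insert_zero (fun t => hv _) hxy (aux x hx).1 (aux y hy).1 (aux x hx).2
      (aux y hy).2 ((hNE _ _).1 hax) ((hNE _ _).1 hay) hm)
  have hvS : ∀ x ∈ S, x ∈ N v := fun x hx => (Finset.mem_sdiff.1 hx).1
  have hSB : ∀ x ∈ S, x ∉ B := fun x hx => (Finset.mem_sdiff.1 hx).2
  have disj : ∀ i, b i ∈ N v → Disjoint (N (a i)) S ∧ Disjoint (N (a (i + 1))) S := by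
    intro i hi
    constructor <;> rw [Finset.disjoint_left] <;> intro x hx hxS
    · exact insertion i (b i) x (hyB x (hSB x hxS) i) (Or.inr ⟨hi, rfl⟩) (Or.inl hxS)
        ((hNE _ _).2 (h.adj_succ i)) hx
    · exact insertion i x (b i) (hyB x (hSB x hxS) i).symm (Or.inl hxS) (Or.inr ⟨hi, rfl⟩)
        hx ((hNE _ _).2 (h.adj i))
  set D := (Finset.range m).filter (fun i => b i ∈ N v) with hD
  have hDc : D.card = (N v ∩ B).card := by
    rw [← Finset.card_image_of_injOn (f := b) (s := D)
      (hinj.mono (by exact_mod_cast Finset.filter_subset _ _))]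
    congr 1
    ext x
    simp only [hD, hB, Finset.mem_image, Finset.mem_filter, Finset.mem_inter]
    constructor
    · rintro ⟨i, ⟨h1, h2⟩, rfl⟩
      exact ⟨h2, i, h1, rfl⟩
    · rintro ⟨h2, i, h1, rfl⟩
      exact ⟨i, ⟨h1, h2⟩, rfl⟩
  have hdeg : (N v).card = S.card + D.card := by
    rw [hDc, hS, Finset.card_sdiff_add_card_inter]
  have cross : ∀ i ∈ D, ∀ j ∈ D, i < j → Disjoint (N (a i) \ B) (N (a j) \ B) := by
    intro i hi j hj hij
    rw [Finset.disjoint_left]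
    intro y hy hy'
    simp only [hD, Finset.mem_filter, Finset.mem_range, Finset.mem_sdiff] at hi hj hy hy'
    refine hno ((h.rotate i).cross_zero (fun t => hv _) (y := y) (fun t => hyB y hy.2 _)
      (j := j - i) (by omega) (by omega) ((hNE _ _).1 hi.2) ?_ ((hNE _ _).1 hy.1) ?_)
    · rw [show i + (j - i) = j by omega]
      exact (hNE _ _).1 hj.2
    · rw [show i + (j - i) = j by omega]
      exact (hNE _ _).1 hy'.1
  have hU : D.card * (k - m) ≤ (D.biUnion fun i => N (a i) \ B).card := by
    rw [Finset.card_biUnion]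
    · rw [← smul_eq_mul]
      refine Finset.card_nsmul_le_sum _ _ _ fun i _ => ?_
      have h1 := Finset.le_card_sdiff B (N (a i))
      have h2 := hk (a i)
      omega
    · intro i hi j hj hij
      rcases lt_or_gt_of_ne hij with hl | hl
      · exact cross i hi j hj hl
      · exact (cross j hj i hi hl).symm
  have hUle : (D.biUnion fun i => N (a i) \ B).card + (S.card + B.card) ≤ Fintype.card β := by
    rw [← Finset.card_union_of_disjoint (Finset.disjoint_left.2 hSB),
      ← Finset.card_union_of_disjoint]
    · exact Finset.card_le_univ _
    · rw [Finset.disjoint_left]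
      intro x hx hx'
      simp only [Finset.mem_biUnion, Finset.mem_sdiff] at hx
      obtain ⟨i, hi, hx1, hx2⟩ := hx
      rcases Finset.mem_union.1 hx' with h1 | h1
      · exact Finset.disjoint_left.1 (disj i (Finset.mem_filter.1 hi).2).1 hx1 h1
      · exact hx2 h1
  have hkv := hk v
  have hd : D.card ≤ 1 := by
    obtain ⟨e, rfl⟩ := Nat.exists_eq_add_of_le hmk
    rw [show m + 2 + e - m = e + 2 by omega] at hU
    by_contra! hd
    nlinarith
  have hSc : Sᶜ.card = Fintype.card β - S.card := Finset.card_compl S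
  have hSle : S.card ≤ Fintype.card β := Finset.card_le_univ S
  have hBS : B ⊆ Sᶜ := fun x hx => Finset.mem_compl.2 fun hxS => hSB x hxS hx
  rcases Nat.lt_or_ge 0 D.card with hpos | hzero
  · obtain ⟨i, hi⟩ := Finset.card_pos.1 hpos
    have hbi : b i ∈ N v := (Finset.mem_filter.1 hi).2
    have hfull : ∀ u, Disjoint (N u) S → N u = Sᶜ := by
      intro u hu
      refine Finset.eq_of_subset_of_card_le
        (fun x hx => Finset.mem_compl.2 (Finset.disjoint_left.1 hu hx)) ?_
      have := hk u
      omega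
    have h0 := hfull _ (disj i hbi).1
    have h1 := hfull _ (disj i hbi).2
    have hki := hk (a i)
    rw [h0] at hki
    refine ⟨by omega, by omega, Sᶜ, b i, by omega, ?_, ?_⟩
    · have hone : (N v ∩ B).card = 1 := by omega
      obtain ⟨x, hx⟩ := Finset.card_eq_one.1 hone
      have hbx : b i ∈ N v ∩ B := Finset.mem_inter.2 ⟨hbi, hbB i⟩
      rw [hx, Finset.mem_singleton] at hbx
      rw [hbx, ← hx]
      ext z
      simp only [hS, Finset.mem_inter, Finset.mem_compl, Finset.mem_sdiff]
      tauto
    · have key : ∀ j < m, N (a (i + j)) = Sᶜ := by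
        intro j hj
        rcases Nat.eq_zero_or_pos j with rfl | hj0
        · exact h0
        · refine hfull _ (Finset.disjoint_left.2 fun y hy hyS => ?_)
          refine hno ((h.rotate i).detour_zero (fun t => hv _) (y := y)
            (fun t => hyB y (hSB y hyS) _) hj0 hj ((hNE _ _).1 hbi) ((hNE _ _).1 (hvS y hyS))
            ((hNE _ _).1 hy) ((hNE _ _).1 ?_))
          rw [h1]
          exact hBS (hbB _)
      intro t
      have hilt : i < m := Finset.mem_range.1 (Finset.mem_filter.1 hi).1
      have : a t = a (i + (t + (m - i)) % m) := by
        rw [h.left_eq_iff]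
        have h2 : i + (t + (m - i)) % m ≡ i + (t + (m - i)) [MOD m] :=
          (Nat.mod_modEq _ _).add_left i
        refine Nat.ModEq.symm (h2.trans ?_)
        rw [show i + (t + (m - i)) = t + m by omega]
        simp [Nat.ModEq]
      rw [this]
      exact key _ (Nat.mod_lt _ hm)
  · have hSv : S = N v := Finset.eq_of_subset_of_card_le Finset.sdiff_subset (by omega)
    have hex : ∀ i, ∃ x, x ∈ N (a i) ∧ x ∈ S := by
      intro i
      by_contra! hcon
      have h1 : (N (a i)).card ≤ Sᶜ.card :=
        Finset.card_le_card fun x hx => Finset.mem_compl.2 (hcon x hx)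
      have := hk (a i)
      omega
    have hstep : ∀ i y z, y ∈ N (a i) → y ∈ S → z ∈ N (a (i + 1)) → z ∈ S → z = y := by
      intro i y z hy hyS hz hzS
      by_contra hne
      exact insertion i z y hne (Or.inl hzS) (Or.inl hyS) hz hy
    obtain ⟨x, hx, hxS⟩ := hex 1
    have huniq : ∀ i, ∀ z ∈ N (a i), z ∈ S → z = x := by
      intro i
      induction i with
      | zero => exact fun z hz hzS => (hstep 0 z x hz hzS hx hxS).symm
      | succ i ih =>
        intro z hz hzS
        obtain ⟨y, hy, hyS⟩ := hex i
        rw [hstep i y z hy hyS hz hzS, ih y hy hyS]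
    have hPc : (insert x Sᶜ).card = Sᶜ.card + 1 :=
      Finset.card_insert_of_notMem (by simpa using hxS)
    have hsub : ∀ i, N (a i) ⊆ insert x Sᶜ := by
      intro i z hz
      by_cases hzS : z ∈ S
      · rw [huniq i z hz hzS]
        exact Finset.mem_insert_self _ _
      · exact Finset.mem_insert_of_mem (Finset.mem_compl.2 hzS)
    have h0 := (hk (a 0)).trans (Finset.card_le_card (hsub 0))
    refine ⟨by omega, by omega, insert x Sᶜ, x, by omega, ?_, fun i => ?_⟩
    · rw [← hSv]
      ext z
      simp only [Finset.mem_inter, Finset.mem_insert, Finset.mem_compl, Finset.mem_singleton]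
      constructor
      · tauto
      · rintro rfl
        exact ⟨hxS, Or.inl rfl⟩
    · refine Finset.eq_of_subset_of_card_le (hsub i) ?_
      have := hk (a i)
      omega

end

open Classical in
theorem exists_perm_mapsTo_pair {β : Type*} {P : Finset β} {u u' x x' : β} (hu : u ∈ P)
    (hu' : u' ∈ P) (hx : x ∈ P) (hx' : x' ∈ P) (huu : u ≠ u') (hxx : x ≠ x') :
    ∃ σ : Equiv.Perm β, σ u = x ∧ σ u' = x' ∧ ∀ p ∈ P, σ p ∈ P := by
  have hswap : ∀ {y z : β}, y ∈ P → z ∈ P → ∀ p ∈ P, Equiv.swap y z p ∈ P := by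
    intro y z hy hz p hp
    rw [Equiv.swap_apply_def]
    split_ifs <;> assumption
  set w := Equiv.swap u x u' with hw
  have hwP : w ∈ P := hswap hu hx _ hu'
  have hwx : w ≠ x := by
    exact fun e => huu ((Equiv.swap u x).injective ((Equiv.swap_apply_left u x).trans e.symm))
  refine ⟨(Equiv.swap u x).trans (Equiv.swap w x'), ?_, ?_, fun p hp => ?_⟩
  · rw [Equiv.trans_apply, Equiv.swap_apply_left, Equiv.swap_apply_of_ne_of_ne hwx.symm hxx]
  · rw [Equiv.trans_apply, ← hw, Equiv.swap_apply_left]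
  · exact hswap hwP hx' _ (hswap hu hx _ hp)

open Classical in
/-- A cycle through `m` left vertices either can be replaced by one through `m + 1` left vertices,
or the neighbourhoods on and off the cycle are two sets sharing one vertex. -/
theorem IsBiCycle.succ_or_split {α β : Type*} [Fintype α] [Fintype β] {E : α → β → Prop}
    {m k : ℕ} {a : ℕ → α} {b : ℕ → β} (h : IsBiCycle E m a b) (hm : 1 ≤ m) (hmk : m + 2 ≤ k)
    (hmα : m + 1 ≤ Fintype.card α) (hn : Fintype.card β + 1 ≤ 2 * k)
    (hk : ∀ u, k ≤ (biNbhd E u).card) (hno : ¬ HasBiCycle E (m + 1)) :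
    Fintype.card β + 1 = 2 * k ∧ ∃ (M : Set α) (P : Finset β) (x : β), M.Nonempty ∧ Mᶜ.Nonempty ∧
      x ∈ P ∧ P.card = k ∧ (∀ u ∈ M, biNbhd E u = P) ∧ ∀ u ∉ M, biNbhd E u = insert x Pᶜ := by
  have hext := fun v hv => h.extend_or_nbhd_eq (v := v) hv hm hmk hn hk hno
  obtain ⟨v, hv⟩ : ∃ v, ∀ i, a i ≠ v := by
    by_contra! hcon
    have hle : (Finset.univ : Finset α) ⊆ (Finset.range m).image a := by
      intro u _
      obtain ⟨i, rfl⟩ := hcon u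
      exact Finset.mem_image.2 ⟨i % m, Finset.mem_range.2 (Nat.mod_lt _ hm),
        (h.left_eq_iff _ _).2 (Nat.mod_modEq i m)⟩
    have h1 := (Finset.card_le_card hle).trans Finset.card_image_le
    rw [Finset.card_univ, Finset.card_range] at h1
    omega
  obtain ⟨hβ, -, P, x, hP, hx, haP⟩ := hext v hv
  have hcompl : Pᶜ.card = k - 1 := by
    rw [Finset.card_compl]
    omega
  have hout : ∀ w, (∀ i, a i ≠ w) → ∃ z ∈ P, biNbhd E w = insert z Pᶜ := by
    intro w hw
    obtain ⟨-, hc, P', z, -, hz, haP'⟩ := hext w hw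
    obtain rfl : P' = P := (haP' 0).symm.trans (haP 0)
    have hzm : z ∈ biNbhd E w ∩ P' := by simp [hz]
    have hle : biNbhd E w ⊆ insert z P'ᶜ := by
      intro y hy
      by_cases hyP : y ∈ P'
      · have : y ∈ biNbhd E w ∩ P' := Finset.mem_inter.2 ⟨hy, hyP⟩
        rw [hz, Finset.mem_singleton] at this
        simp [this]
      · simp [hyP]
    refine ⟨z, (Finset.mem_inter.1 hzm).2, Finset.eq_of_subset_of_card_le hle ?_⟩
    have := Finset.card_insert_le z P'ᶜ
    omega
  have hxP : x ∈ P := by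
    have : x ∈ biNbhd E v ∩ P := by simp [hx]
    exact (Finset.mem_inter.1 this).2
  have hvN : biNbhd E v = insert x Pᶜ := by
    obtain ⟨z, hzP, hz⟩ := hout v hv
    have : z ∈ biNbhd E v ∩ P := by simp [hz, hzP]
    rw [hx, Finset.mem_singleton] at this
    rw [hz, this]
  obtain ⟨y, hy, y', hy', hyy⟩ := Finset.one_lt_card.1 (show 1 < Pᶜ.card by omega)
  refine ⟨hβ, Set.range a, P, x, ⟨a 0, 0, rfl⟩, ⟨v, fun ⟨i, hi⟩ => hv i hi⟩, hxP, hP, ?_, ?_⟩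
  · rintro _ ⟨i, rfl⟩
    exact haP i
  · intro w hw
    have hw' : ∀ i, a i ≠ w := fun i hi => hw ⟨i, hi⟩
    obtain ⟨x', hx'P, hwN⟩ := hout w hw'
    by_contra hne
    have hxx : x ≠ x' := fun e => hne (e ▸ hwN)
    have hvw : v ≠ w := fun e => hne (e ▸ hvN)
    have hEv : ∀ z ∈ Pᶜ, E v z := fun z hz => mem_biNbhd.1 (by simp [hvN, Finset.mem_compl.1 hz])
    have hEw : ∀ z ∈ Pᶜ, E w z := fun z hz => mem_biNbhd.1 (by simp [hwN, Finset.mem_compl.1 hz])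
    have hvx : E v x := mem_biNbhd.1 (by simp [hvN])
    have hwx : E w x' := mem_biNbhd.1 (by simp [hwN])
    rcases Nat.lt_or_ge m 2 with hm1 | hm2
    · obtain rfl : m = 1 := by omega
      have hc : IsBiCycle E 1 (fun _ => w) (fun _ => y) :=
        ⟨fun i j => by simp [Nat.modEq_one], fun i j => by simp [Nat.modEq_one],
          fun _ => hEw y hy, fun _ => hEw y hy⟩
      exact hno (hc.insert_zero (fun _ => hvw.symm) hyy (fun i _ _ => by omega)
        (fun i _ _ => by omega) (hEv y hy) (hEv y' hy') (hEw y hy) (hEw y' hy') le_rfl)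
    · have haE : ∀ i z, E (a i) z ↔ z ∈ P := fun i z => by rw [← mem_biNbhd (E := E), haP]
      obtain ⟨σ, hσ0, hσ1, hσP⟩ := exists_perm_mapsTo_pair (u := b 0) (u' := b 1)
        ((haE _ _).1 (h.adj 0)) ((haE _ _).1 (h.adj 1)) hxP hx'P
        (h.right_ne (by omega) (by omega)) hxx
      have hσ : ∀ i, σ (b i) ∈ P := fun i => hσP _ ((haE _ _).1 (h.adj i))
      have hc : IsBiCycle E m a (fun i => σ (b i)) :=
        ⟨h.left_eq_iff, fun i j => σ.injective.eq_iff.trans (h.right_eq_iff i j),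
          fun i => (haE _ _).2 (hσ i), fun i => (haE _ _).2 (hσ i)⟩
      refine hno (hc.replace_one hv hw' hvw (y := y)
        (fun i e => Finset.mem_compl.1 hy (e ▸ hσ i)) hm2 (hEv y hy) (hEw y hy) ?_ ?_)
      · rwa [hσ0]
      · rwa [hσ1]

/-- Lemma (Hall et al.): let $G$ be bipartite with bipartition $\{M,N\}$, $|M| ≥ 2$,
$|N| ≥ 4$ and $δ(M) ≥ (|N|+1)/2$. Then $G$ has a cycle of length $2ℓ$ for every
$2 ≤ ℓ ≤ \min\{|M|, δ(M)-1\}$, or $Δ(M) = (|N|+1)/2$ (so every vertex of $M$ has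
degree exactly $(|N|+1)/2$) and $M, N$ split as described. -/
theorem bipartite_cycles_or_split {α β : Type*} [Fintype α] [Fintype β]
    (E : α → β → Prop)
    (hM : 2 ≤ Fintype.card α) (hN : 4 ≤ Fintype.card β)
    (hδ : ∀ a : α, Fintype.card β + 1 ≤ 2 * {b | E a b}.ncard) :
    (∀ ℓ : ℕ, 2 ≤ ℓ → ℓ ≤ Fintype.card α →
        (∀ a : α, ℓ + 1 ≤ {b | E a b}.ncard) → HasCycleLen (biAdj E) (2 * ℓ)) ∨
      ((∀ a : α, 2 * {b | E a b}.ncard = Fintype.card β + 1) ∧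
        ∃ (M₁ M₂ : Set α) (N₁ N₂ N₃ : Set β),
          M₁.Nonempty ∧ M₂.Nonempty ∧ N₁.Nonempty ∧ N₂.Nonempty ∧ N₃.Nonempty ∧
          Disjoint M₁ M₂ ∧ Disjoint N₁ N₂ ∧ Disjoint N₁ N₃ ∧ Disjoint N₂ N₃ ∧
          M₁ ∪ M₂ = Set.univ ∧ N₁ ∪ N₂ ∪ N₃ = Set.univ ∧
          N₃.ncard = 1 ∧ N₁.ncard = N₂.ncard ∧
          (∀ a ∈ M₁, (∀ b ∈ N₁ ∪ N₃, E a b) ∧ ∀ b ∈ N₂, ¬ E a b) ∧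
          (∀ a ∈ M₂, (∀ b ∈ N₂ ∪ N₃, E a b) ∧ ∀ b ∈ N₁, ¬ E a b)) := by
  classical
  by_cases hcyc : ∀ ℓ : ℕ, 2 ≤ ℓ → ℓ ≤ Fintype.card α →
      (∀ a : α, ℓ + 1 ≤ {b | E a b}.ncard) → HasCycleLen (biAdj E) (2 * ℓ)
  · exact Or.inl hcyc
  right
  push Not at hcyc
  obtain ⟨ℓ, hℓ2, hℓα, hℓd, hnc⟩ := hcyc
  obtain ⟨k, hk, hℓk, hnk⟩ : ∃ k, (∀ u, k ≤ (biNbhd E u).card) ∧ ℓ + 1 ≤ k ∧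
      Fintype.card β + 1 ≤ 2 * k := by
    refine ⟨max (ℓ + 1) ((Fintype.card β + 2) / 2), fun u => ?_, le_max_left _ _, ?_⟩
    · have h1 := hℓd u
      have h2 := hδ u
      rw [ncard_eq_card_biNbhd] at h1 h2
      exact max_le h1 (by omega)
    · have := le_max_right (ℓ + 1) ((Fintype.card β + 2) / 2)
      omega
  have hno : ¬ HasBiCycle E ℓ := fun ⟨_, _, h⟩ => hnc h.hasCycleLen
  obtain ⟨m, hm1, hmℓ, ⟨a, b, hab⟩, hno'⟩ :
      ∃ m, 1 ≤ m ∧ m < ℓ ∧ HasBiCycle E m ∧ ¬ HasBiCycle E (m + 1) := by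
    by_contra! hcon
    have hall : ∀ m, 1 ≤ m → m ≤ ℓ → HasBiCycle E m := by
      intro m hm1
      induction m, hm1 using Nat.le_induction with
      | base =>
        intro _
        obtain ⟨u⟩ : Nonempty α := Fintype.card_pos_iff.1 (by omega)
        obtain ⟨x, hx⟩ := Finset.card_pos.1 (show 0 < (biNbhd E u).card from by
          have := hk u; omega)
        exact ⟨fun _ => u, fun _ => x, fun i j => by simp [Nat.modEq_one],
          fun i j => by simp [Nat.modEq_one], fun _ => mem_biNbhd.1 hx, fun _ => mem_biNbhd.1 hx⟩
      | succ m hm ih => exact fun hle => hcon m hm hle (ih (by omega))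
    exact hno (hall ℓ (by omega) le_rfl)
  obtain ⟨hβ, M, P, x, hMne, hMc, hxP, hPk, hin, hout⟩ :=
    hab.succ_or_split hm1 (by omega) (by omega) hnk hk hno'
  have hE : ∀ u z, E u z ↔ z ∈ biNbhd E u := fun u z => mem_biNbhd.symm
  have hcompl : Pᶜ.card = k - 1 := by
    rw [Finset.card_compl]
    omega
  have herase : (P.erase x).card = k - 1 := by
    rw [Finset.card_erase_of_mem hxP, hPk]
  have hins : (insert x Pᶜ).card = k := by
    rw [Finset.card_insert_of_notMem (by simpa using hxP)]
    omega
  refine ⟨fun u => ?_, M, Mᶜ, (P.erase x : Finset β), (Pᶜ : Finset β), {x}, hMne, hMc, ?_, ?_,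
    Set.singleton_nonempty x, disjoint_compl_right, ?_, ?_, ?_, Set.union_compl_self M, ?_,
    Set.ncard_singleton x, ?_, ?_, ?_⟩
  · rw [ncard_eq_card_biNbhd]
    by_cases hu : u ∈ M
    · rw [hin u hu]; omega
    · rw [hout u hu]; omega
  · exact Finset.coe_nonempty.2 (Finset.card_pos.1 (by omega))
  · exact Finset.coe_nonempty.2 (Finset.card_pos.1 (by omega))
  · rw [Finset.disjoint_coe, Finset.disjoint_left]
    intro z hz
    simpa using Finset.mem_of_mem_erase hz
  · simp
  · simpa using hxP
  · ext z
    simp only [Finset.coe_erase, Finset.coe_compl, Set.mem_union, Set.mem_sdiff, Finset.mem_coe,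
      Set.mem_singleton_iff, Set.mem_compl_iff, Set.mem_univ, iff_true]
    tauto
  · rw [Set.ncard_coe_finset, Set.ncard_coe_finset, herase, hcompl]
  · intro u hu
    simp only [hE, hin u hu, Set.mem_union, Finset.mem_coe, Finset.mem_erase,
      Finset.mem_compl, Set.mem_singleton_iff]
    refine ⟨?_, fun z hz => hz⟩
    rintro z (hz | rfl)
    exacts [hz.2, hxP]
  · intro u hu
    simp only [hE, hout u hu, Set.mem_union, Finset.mem_coe, Finset.mem_erase,
      Finset.mem_compl, Set.mem_singleton_iff, Finset.mem_insert]
    exact ⟨fun z hz => hz.symm, fun z hz => by tauto⟩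
end

section
/- Let G be a bipartite graph with bipartition {M, N} such that |M| ≥ 2, |N| ≥ 3 and δ(M) ≥ |N|/2, and let ℓ = min{|M|, δ(M)}. Then either G has a path on 2ℓ − 1 vertices with both ends in M, or there are nonempty pairwise disjoint sets M_1, M_2, N_1, N_2 with M = M_1 ∪ M_2 and N = N_1 ∪ N_2, |N_1| = |N_2|, such that for each i ∈ {1,2}, every vertex of M_i is adjacent to every vertex of N_i and to no vertex of N_{3−i}. Moreover, if |M| ≥ 2ℓ − 3 and |N| = 2ℓ, then G has a path on 2ℓ − 3 vertices with both ends in N. -/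
/-- `a 0, b 0, a 1, b 1, …, b (s - 1), a s` is a path of the bipartite graph given by `E`. -/
structure IsAltPath {α β : Type*} (E : α → β → Prop) (s : ℕ) (a : ℕ → α) (b : ℕ → β) : Prop where
  inj_left : ∀ i j, i ≤ s → j ≤ s → a i = a j → i = j
  inj_right : ∀ i j, i < s → j < s → b i = b j → i = j
  adj : ∀ i, i < s → E (a i) (b i)
  adj_succ : ∀ i, i < s → E (a (i + 1)) (b i)

/-- `a 0, b 0, a 1, b 1, …, a s, b s` is a cycle (possibly degenerate, if `s = 0`) of the
bipartite graph given by `E`. -/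
structure IsAltCycle {α β : Type*} (E : α → β → Prop) (s : ℕ) (a : ℕ → α) (b : ℕ → β) : Prop where
  inj_left : ∀ i j, i ≤ s → j ≤ s → a i = a j → i = j
  inj_right : ∀ i j, i ≤ s → j ≤ s → b i = b j → i = j
  adj : ∀ i, i ≤ s → E (a i) (b i)
  adj_succ : ∀ i, i < s → E (a (i + 1)) (b i)
  adj_zero : E (a 0) (b s)

section AltPath

variable {α β : Type*} {E : α → β → Prop} {s : ℕ} {a : ℕ → α} {b : ℕ → β}

theorem IsAltPath.reverse (h : IsAltPath E s a b) :
    IsAltPath E s (fun j => a (s - j)) (fun j => b (s - 1 - j)) where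
  inj_left i j hi hj e := by
    have := h.inj_left _ _ (by omega) (by omega) e
    omega
  inj_right i j hi hj e := by
    have := h.inj_right _ _ (by omega) (by omega) e
    omega
  adj i hi := by
    have := h.adj_succ (s - 1 - i) (by omega)
    rwa [show s - 1 - i + 1 = s - i by omega] at this
  adj_succ i hi := by
    have := h.adj (s - 1 - i) (by omega)
    rwa [show s - 1 - i = s - (i + 1) by omega] at this ⊢

theorem IsAltPath.rotate (h : IsAltPath E s a b) {i : ℕ} (hi : i < s) (hE : E (a 0) (b i)) :
    IsAltPath E s (fun j => a (if j ≤ i then i - j else j))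
      (fun j => b (if j < i then i - 1 - j else j)) where
  inj_left x y hx hy e := by
    have := h.inj_left _ _ (by split_ifs <;> omega) (by split_ifs <;> omega) e
    split_ifs at this <;> omega
  inj_right x y hx hy e := by
    have := h.inj_right _ _ (by split_ifs <;> omega) (by split_ifs <;> omega) e
    split_ifs at this <;> omega
  adj x hx := by
    rcases lt_trichotomy x i with hxi | rfl | hxi
    · have := h.adj_succ (i - 1 - x) (by omega)
      rw [show i - 1 - x + 1 = i - x by omega] at this
      simpa [hxi, hxi.le] using this
    · simpa using hE
    · simpa [hxi.not_ge, hxi.not_gt] using h.adj x hx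
  adj_succ x hx := by
    rcases lt_trichotomy x i with hxi | rfl | hxi
    · have := h.adj (i - 1 - x) (by omega)
      rw [show i - 1 - x = i - (x + 1) by omega] at this
      simpa [hxi, Nat.succ_le_of_lt hxi, show i - 1 - x = i - (x + 1) by omega] using this
    · simpa using h.adj_succ x hx
    · simpa [hxi.not_gt, show ¬ x + 1 ≤ i by omega] using h.adj_succ x hx

theorem IsAltPath.cons (h : IsAltPath E s a b) {v : α} {y : β} (hv : ∀ i ≤ s, a i ≠ v)
    (hy : ∀ i < s, b i ≠ y) (hvy : E v y) (hay : E (a 0) y) :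
    IsAltPath E (s + 1) (fun j => if j = 0 then v else a (j - 1))
      (fun j => if j = 0 then y else b (j - 1)) where
  inj_left i j hi hj e := by
    split_ifs at e with h1 h2 h2
    · omega
    · exact absurd e.symm (hv _ (by omega))
    · exact absurd e (hv _ (by omega))
    · have := h.inj_left _ _ (by omega) (by omega) e
      omega
  inj_right i j hi hj e := by
    split_ifs at e with h1 h2 h2
    · omega
    · exact absurd e.symm (hy _ (by omega))
    · exact absurd e (hy _ (by omega))
    · have := h.inj_right _ _ (by omega) (by omega) e
      omega
  adj i hi := by
    rcases i with _ | i
    · simpa using hvy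
    · simpa using h.adj i (by omega)
  adj_succ i hi := by
    rcases i with _ | i
    · simpa using hay
    · simpa using h.adj_succ i (by omega)

theorem IsAltPath.replace (h : IsAltPath E s a b) {v : α} {i : ℕ} (hv : ∀ i ≤ s, a i ≠ v)
    (hi : i < s) (hE : E v (b (i - 1))) (hE' : E v (b i)) :
    IsAltPath E s (Function.update a i v) b where
  inj_left x y hx hy e := by
    simp only [Function.update_apply] at e
    split_ifs at e with h1 h2 h2
    · omega
    · exact absurd e.symm (hv _ hy)
    · exact absurd e (hv _ hx)
    · exact h.inj_left _ _ hx hy e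
  inj_right := h.inj_right
  adj x hx := by
    by_cases hxi : x = i
    · subst hxi
      simpa using hE'
    · simpa [Function.update_apply, hxi] using h.adj x hx
  adj_succ x hx := by
    by_cases hxi : x + 1 = i
    · subst hxi
      simpa using hE
    · simpa [Function.update_apply, hxi] using h.adj_succ x hx

theorem IsAltPath.closeUp (h : IsAltPath E s a b) {y : β} (hy : ∀ i < s, b i ≠ y)
    (h0 : E (a 0) y) (hs : E (a s) y) : IsAltCycle E s a (Function.update b s y) where
  inj_left := h.inj_left
  inj_right i j hi hj e := by
    simp only [Function.update_apply] at e
    split_ifs at e with h1 h2 h2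
    · omega
    · exact absurd e.symm (hy _ (by omega))
    · exact absurd e (hy _ (by omega))
    · exact h.inj_right _ _ (by omega) (by omega) e
  adj i hi := by
    by_cases his : i = s
    · subst his
      simpa using hs
    · simpa [Function.update_apply, his] using h.adj i (by omega)
  adj_succ i hi := by
    simpa [Function.update_apply, hi.ne] using h.adj_succ i hi
  adj_zero := by simpa using h0

/-- Crossing chords at the two ends of a path give a cycle through all but one `a i`. -/
theorem IsAltPath.cycle_of_chords (h : IsAltPath E s a b) {i : ℕ} (hi : 0 < i) (his : i < s)
    (h0 : E (a 0) (b i)) (hs : E (a s) (b (i - 1))) :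
    IsAltCycle E (s - 1) (fun j => a (if i + 1 + j ≤ s then i + 1 + j else s - 1 - j))
      (fun j => b (if i + 1 + j < s then i + 1 + j else if j + 1 = s then i else s - 2 - j)) where
  inj_left x y hx hy e := by
    have := h.inj_left _ _ (by split_ifs <;> omega) (by split_ifs <;> omega) e
    split_ifs at this <;> omega
  inj_right x y hx hy e := by
    have := h.inj_right _ _ (by split_ifs <;> omega) (by split_ifs <;> omega) e
    split_ifs at this <;> omega
  adj x hx := by
    rcases lt_trichotomy (i + 1 + x) s with h1 | h1 | h1
    · simpa [h1, h1.le] using h.adj _ h1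
    · rw [if_pos h1.le, if_neg (by omega), if_neg (by omega), h1,
        show s - 2 - x = i - 1 by omega]
      exact hs
    · rw [if_neg (by omega), if_neg (by omega)]
      split_ifs with h2
      · rwa [show s - 1 - x = 0 by omega]
      · have := h.adj_succ (s - 2 - x) (by omega)
        rwa [show s - 2 - x + 1 = s - 1 - x by omega] at this
  adj_succ x hx := by
    rcases lt_or_ge (i + 1 + x) s with h1 | h1
    · rw [if_pos (by omega), if_pos h1]
      exact h.adj_succ _ h1
    · rw [if_neg (by omega), if_neg (by omega), if_neg (by omega),
        show s - 1 - (x + 1) = s - 2 - x by omega]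
      exact h.adj _ (by omega)
  adj_zero := by
    rw [if_pos (by omega), if_neg (by omega), if_pos (by omega)]
    exact h.adj_succ _ his

theorem IsAltCycle.toPath (h : IsAltCycle E s a b) {j : ℕ} (hj : j ≤ s) :
    IsAltPath E s (fun x => a (if j + 1 + x ≤ s then j + 1 + x else j + x - s))
      (fun x => b (if j + 1 + x ≤ s then j + 1 + x else j + x - s)) where
  inj_left x y hx hy e := by
    have := h.inj_left _ _ (by split_ifs <;> omega) (by split_ifs <;> omega) e
    split_ifs at this <;> omega
  inj_right x y hx hy e := by
    have := h.inj_right _ _ (by split_ifs <;> omega) (by split_ifs <;> omega) e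
    split_ifs at this <;> omega
  adj x hx := h.adj _ (by split_ifs <;> omega)
  adj_succ x hx := by
    rcases lt_trichotomy (j + 1 + x) s with h1 | h1 | h1
    · rw [if_pos (by omega), if_pos (by omega)]
      exact h.adj_succ _ h1
    · rw [if_neg (by omega), if_pos (by omega), h1, show j + (x + 1) - s = 0 by omega]
      exact h.adj_zero
    · rw [if_neg (by omega), if_neg (by omega), show j + (x + 1) - s = j + x - s + 1 by omega]
      exact h.adj_succ _ (by omega)

/-- A vertex off a cycle that is adjacent to some `b j` on it starts a path through the cycle. -/
theorem IsAltCycle.cons (h : IsAltCycle E s a b) {v : α} {j : ℕ} (hj : j ≤ s)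
    (hv : ∀ i ≤ s, a i ≠ v) (hE : E v (b j)) :
    ∃ a' b', IsAltPath E (s + 1) a' b' ∧ (∀ i ≤ s + 1, a' i = v ∨ ∃ x ≤ s, a' i = a x) ∧
      ∀ i < s + 1, ∃ x ≤ s, b' i = b x := by
  refine ⟨_, _, (h.toPath hj).cons (v := v) (y := b j) ?_ ?_ hE ?_, ?_, ?_⟩
  · intro i hi
    exact hv _ (by split_ifs <;> omega)
  · intro i hi e
    have := h.inj_right _ _ (by split_ifs <;> omega) hj e
    split_ifs at this <;> omega
  · split_ifs with h1
    · exact h.adj_succ _ (by omega)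
    · rw [show j = s by omega, show s + 0 - s = 0 by omega]
      exact h.adj_zero
  · intro i hi
    by_cases h0 : i = 0
    · exact Or.inl (by simp [h0])
    · exact Or.inr ⟨_, by split_ifs <;> omega, if_neg h0⟩
  · intro i hi
    by_cases h0 : i = 0
    · exact ⟨j, hj, by simp [h0]⟩
    · exact ⟨_, by split_ifs <;> omega, if_neg h0⟩

/-- If no path is longer, a vertex off a cycle has no common neighbour with the cycle. -/
theorem IsAltCycle.not_common (h : IsAltCycle E s a b)
    (hmax : ∀ a' b', ¬ IsAltPath E (s + 1) a' b') {v : α} (hv : ∀ i ≤ s, a i ≠ v)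
    {i : ℕ} (hi : i ≤ s) {y : β} (hvy : E v y) : ¬ E (a i) y := by
  intro hay
  by_cases hy : ∃ j ≤ s, b j = y
  · obtain ⟨j, hj, rfl⟩ := hy
    obtain ⟨a', b', h', -⟩ := h.cons hj hv hvy
    exact hmax _ _ h'
  · push Not at hy
    rcases i with _ | i
    · refine hmax _ _ ((h.toPath le_rfl).cons (v := v) (y := y) ?_ ?_ hvy ?_)
      · intro x hx
        exact hv _ (by split_ifs <;> omega)
      · intro x hx
        exact hy _ (by split_ifs <;> omega)
      · simpa using hay
    · refine hmax _ _ ((h.toPath (j := i) (by omega)).cons (v := v) (y := y) ?_ ?_ hvy ?_)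
      · intro x hx
        exact hv _ (by split_ifs <;> omega)
      · intro x hx
        exact hy _ (by split_ifs <;> omega)
      · simpa [hi] using hay

/-- The ends of a longest path have no common neighbour off the path with a vertex off the path. -/
theorem IsAltPath.head_disjoint (h : IsAltPath E s a b)
    (hmax : ∀ a' b', ¬ IsAltPath E (s + 1) a' b') {v : α} (hv : ∀ i ≤ s, a i ≠ v)
    {y : β} (hy : ∀ i < s, b i ≠ y) (h0 : E (a 0) y) : ¬ E v y :=
  fun hvy => hmax _ _ (h.cons hv hy hvy h0)

theorem IsAltPath.last_disjoint (h : IsAltPath E s a b)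
    (hmax : ∀ a' b', ¬ IsAltPath E (s + 1) a' b') {v : α} (hv : ∀ i ≤ s, a i ≠ v)
    {y : β} (hy : ∀ i < s, b i ≠ y) (h0 : E (a s) y) : ¬ E v y :=
  h.reverse.head_disjoint hmax (fun i _ => hv _ (by omega)) (fun i _ => hy _ (by omega))
    (by simpa using h0)

/-- In a longest path that cannot be closed up, an inner vertex hit by crossing chords from the
two ends shares no neighbour off the path with the ends or with a vertex off the path. -/
theorem IsAltPath.inner_disjoint (h : IsAltPath E s a b)
    (hmax : ∀ a' b', ¬ IsAltPath E (s + 1) a' b') (hcyc : ∀ a' b', ¬ IsAltCycle E s a' b')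
    {v : α} (hv : ∀ i ≤ s, a i ≠ v) {i : ℕ} (hi : 0 < i) (his : i < s)
    (h0 : E (a 0) (b i)) (hs : E (a s) (b (i - 1)))
    {y : β} (hy : ∀ i < s, b i ≠ y) (hiy : E (a i) y) :
    ¬ E v y ∧ ¬ E (a 0) y ∧ ¬ E (a s) y := by
  have hr := h.rotate his h0
  have hr' := h.reverse.rotate (i := s - i) (by omega)
    (by simpa [show s - 1 - (s - i) = i - 1 by omega] using hs)
  refine ⟨hr.head_disjoint hmax ?_ ?_ ?_, fun h1 => hcyc _ _ (hr'.closeUp (y := y) ?_ ?_ ?_),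
    fun h1 => hcyc _ _ (hr.closeUp (y := y) ?_ ?_ ?_)⟩
  · exact fun j hj => hv _ (by split_ifs <;> omega)
  · exact fun j hj => hy _ (by split_ifs <;> omega)
  · simpa using hiy
  · exact fun j hj => hy _ (by omega)
  · simpa [show s - (s - i) = i by omega] using hiy
  · rw [if_neg (by omega)]
    simpa using h1
  · exact fun j hj => hy _ (by split_ifs <;> omega)
  · simpa using hiy
  · rwa [if_neg (by omega)]

end AltPath


section Counting

variable {α β : Type*}

open Finset

open scoped Classical in
/-- If no path meets more than `s + 1` vertices of the first class and no such path closes up to a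
cycle, then there is a path missing a vertex with more neighbours on the path than `v` has. -/
theorem exists_altPath_missing_more [Fintype β] {E : α → β → Prop} {k s : ℕ}
    (hk : ∀ x, k ≤ #{y | E x y}) (hn : Fintype.card β ≤ 2 * k) (hs : s + 2 ≤ k)
    (hmax : ∀ a b, ¬ IsAltPath E (s + 1) a b) (hcyc : ∀ a b, ¬ IsAltCycle E s a b)
    {a : ℕ → α} {b : ℕ → β} (h : IsAltPath E s a b) {v : α} (hv : ∀ i ≤ s, a i ≠ v) :
    ∃ a' b' v', IsAltPath E s a' b' ∧ (∀ i ≤ s, a' i ≠ v') ∧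
      #{y ∈ (range s).image b | E v y} < #{y ∈ (range s).image b' | E v' y} := by
  by_contra! hbest
  set B := (range s).image b with hB
  have hBcard : #B = s := by
    rw [hB, card_image_of_injOn, card_range]
    intro i hi j hj e
    exact h.inj_right i j (by simpa using hi) (by simpa using hj) e
  let p : α → ℕ := fun x => #{y ∈ B | E x y}
  let N : α → Finset β := fun x => {y ∈ Bᶜ | E x y}
  let I : α → Finset ℕ := fun x => {i ∈ range s | E x (b i)}
  have hpN : ∀ x, k ≤ p x + #(N x) := by
    intro x
    refine (hk x).trans (le_trans (card_le_card ?_) (card_union_le _ _))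
    intro y hy
    by_cases hyB : y ∈ B <;> simp_all [N]
  have hIp : ∀ x, #(I x) = p x := by
    intro x
    have : ({y ∈ B | E x y} : Finset β) = (I x).image b := by
      rw [hB, filter_image]
    change _ = #{y ∈ B | E x y}
    rw [this, card_image_of_injOn]
    intro i hi j hj e
    simp only [I, coe_filter, mem_range, Set.mem_ofPred_eq] at hi hj
    exact h.inj_right i j hi.1 hj.1 e
  have hps : ∀ x, p x ≤ s := fun x => hBcard ▸ card_filter_le _ _
  have hNB : ∀ {x y}, y ∈ N x → (∀ i < s, b i ≠ y) ∧ E x y := by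
    intro x y hy
    simp only [N, hB, mem_filter, mem_compl, mem_image, mem_range, not_exists, not_and] at hy
    exact hy
  let W : Finset ℕ := {i ∈ range s | 0 < i ∧ E (a 0) (b i) ∧ E (a s) (b (i - 1))}
  have hW : ∀ {i}, i ∈ W → i < s ∧ 0 < i ∧ E (a 0) (b i) ∧ E (a s) (b (i - 1)) := by
    intro i hi
    simpa [W] using hi
  have hsum : ∀ Y ⊆ W, (∀ i ∈ Y, ∀ j ∈ Y, i ≠ j → Disjoint (N (a i)) (N (a j))) →
      (#Y + 1) * k + s ≤ p (a 0) + p (a s) + p v + ∑ i ∈ Y, p (a i) := by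
    intro Y hYW hY
    have hd1 : Disjoint (N (a 0)) (N (a s)) := by
      rw [disjoint_left]
      intro y hy hy'
      exact hcyc _ _ (h.closeUp (hNB hy).1 (hNB hy).2 (hNB hy').2)
    have hd2 : Disjoint (N (a 0) ∪ N (a s)) (N v) := by
      rw [disjoint_left]
      intro y hy hy'
      rcases mem_union.1 hy with hy | hy
      · exact h.head_disjoint hmax hv (hNB hy).1 (hNB hy).2 (hNB hy').2
      · exact h.last_disjoint hmax hv (hNB hy).1 (hNB hy).2 (hNB hy').2
    have hd3 : Disjoint (N (a 0) ∪ N (a s) ∪ N v) (Y.biUnion fun i => N (a i)) := by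
      rw [disjoint_left]
      intro y hy hy'
      obtain ⟨i, hi, hiy⟩ := mem_biUnion.1 hy'
      obtain ⟨h1, h2, h3, h4⟩ := hW (hYW hi)
      have := h.inner_disjoint hmax hcyc hv h2 h1 h3 h4 (hNB hiy).1 (hNB hiy).2
      simp only [mem_union] at hy
      rcases hy with (hy | hy) | hy
      · exact this.2.1 (hNB hy).2
      · exact this.2.2 (hNB hy).2
      · exact this.1 (hNB hy).2
    have hle : #(N (a 0) ∪ N (a s) ∪ N v ∪ Y.biUnion fun i => N (a i)) ≤ #Bᶜ := by
      refine card_le_card ?_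
      intro y hy
      simp only [mem_union, mem_biUnion, N, mem_filter] at hy
      tauto
    rw [card_union_of_disjoint hd3, card_union_of_disjoint hd2, card_union_of_disjoint hd1,
      card_biUnion hY, card_compl, hBcard] at hle
    have hsB : s ≤ Fintype.card β := hBcard ▸ card_le_univ B
    have hYk : #Y * k ≤ ∑ i ∈ Y, p (a i) + ∑ i ∈ Y, #(N (a i)) := by
      rw [← sum_add_distrib, ← smul_eq_mul]
      exact card_nsmul_le_sum _ _ _ fun i _ => hpN _
    have := hpN (a 0)
    have := hpN (a s)
    have := hpN v
    rw [add_mul]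
    omega
  have hWcard : p (a 0) + p (a s) ≤ #W + s + 1 := by
    have hJ : #((I (a s)).image (· + 1)) = p (a s) := by
      rw [card_image_of_injective _ (add_left_injective 1), hIp]
    have h1 := card_union_add_card_inter (I (a 0)) ((I (a s)).image (· + 1))
    have h2 : #(I (a 0) ∪ (I (a s)).image (· + 1)) ≤ #(range (s + 1)) := by
      refine card_le_card ?_
      intro i hi
      simp only [I, mem_union, mem_filter, mem_image, mem_range] at hi ⊢
      rcases hi with hi | ⟨j, hj, rfl⟩ <;> omega
    have h3 : #(I (a 0) ∩ (I (a s)).image (· + 1)) ≤ #W := by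
      refine card_le_card ?_
      intro i hi
      simp only [I, mem_inter, mem_filter, mem_image, mem_range] at hi
      obtain ⟨hi, j, hj, rfl⟩ := hi
      simpa [W] using ⟨hi.1, hi.2, hj.2⟩
    rw [card_range] at h2
    rw [hIp, hJ] at h1
    omega
  let Z : Finset ℕ := {i ∈ W | E v (b (i - 1)) ∧ E v (b i)}
  have hZcard : #W + 2 * p v ≤ #Z + 2 * s := by
    have h1 : #(range s \ I v) + p v = s := by
      rw [← hIp, card_sdiff_add_card_eq_card (filter_subset _ _), card_range]
    have h2 : #W ≤ #(Z ∪ (range s \ I v) ∪ (range s \ I v).image (· + 1)) := by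
      refine card_le_card ?_
      intro i hi
      have hi' := hW hi
      by_cases hvi : E v (b i)
      · by_cases hvi' : E v (b (i - 1))
        · simp [Z, hi, hvi, hvi']
        · refine mem_union_right _ (mem_image.2 ⟨i - 1, ?_, by omega⟩)
          simp only [I, mem_sdiff, mem_range, mem_filter, not_and]
          exact ⟨by omega, fun _ => hvi'⟩
      · refine mem_union_left _ (mem_union_right _ ?_)
        simp [I, hi'.1, hvi]
    have h3 := card_union_le (Z ∪ (range s \ I v)) ((range s \ I v).image (· + 1))
    have h4 := card_union_le Z (range s \ I v)
    have h5 : #((range s \ I v).image (· + 1)) ≤ #(range s \ I v) := card_image_le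
    omega
  have hempty := hsum ∅ (empty_subset _) (by simp)
  simp only [card_empty, sum_empty] at hempty
  have hv0 := hps v
  have hpW : ∀ i ∈ W, p (a i) ≤ p v := by
    intro i hi
    obtain ⟨h1, h2, h3, h4⟩ := hW hi
    have hpos : 0 < #(I v) := by
      have := hps (a 0)
      have := hps (a s)
      have := hIp v
      omega
    obtain ⟨j, hj⟩ := card_pos.1 hpos
    simp only [I, mem_filter, mem_range] at hj
    have hc := h.cycle_of_chords h2 h1 h3 h4
    obtain ⟨j', hj', hbj'⟩ : ∃ j' ≤ s - 1,
        (if i + 1 + j' < s then i + 1 + j' else if j' + 1 = s then i else s - 2 - j') = j := by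
      rcases lt_trichotomy j i with hji | rfl | hji
      · exact ⟨s - 2 - j, by omega, by split_ifs <;> omega⟩
      · exact ⟨s - 1, by omega, by split_ifs <;> omega⟩
      · exact ⟨j - (i + 1), by omega, by split_ifs <;> omega⟩
    obtain ⟨a', b', h', ha', hb'⟩ := hc.cons (v := v) hj'
      (fun x hx => hv _ (by split_ifs <;> omega)) (by rw [hbj']; exact hj.2)
    rw [show s - 1 + 1 = s by omega] at h' ha' hb'
    have hle := hbest a' b' (a i) h' (by
      intro x hx e
      rcases ha' x hx with hx' | ⟨y, hy, hxy⟩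
      · exact hv i h1.le (e ▸ hx')
      · have := h.inj_left _ _ (by split_ifs <;> omega) h1.le (hxy.symm.trans e)
        split_ifs at this <;> omega)
    have hBB : (range s).image b' = B := by
      refine eq_of_subset_of_card_le ?_ ?_
      · intro y hy
        obtain ⟨x, hx, rfl⟩ := mem_image.1 hy
        obtain ⟨x', hx', e⟩ := hb' x (by simpa using hx)
        rw [e]
        exact mem_image_of_mem _ (mem_range.2 (by split_ifs <;> omega))
      · rw [hBcard, card_image_of_injOn, card_range]
        intro x hx y hy e
        exact h'.inj_right x y (by simpa using hx) (by simpa using hy) e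
    rwa [hBB] at hle
  have hWpos : 0 < #W := by
    have := hps (a 0)
    omega
  obtain ⟨i₀, hi₀⟩ := card_pos.1 hWpos
  have hsingle := hsum {i₀} (by simpa using hi₀) (by simp)
  simp only [card_singleton, sum_singleton] at hsingle
  have := hpW i₀ hi₀
  have hZW : Z ⊆ W := filter_subset _ _
  have hZ := hsum Z hZW (by
    intro i hi j hj hij
    rw [disjoint_left]
    intro y hy hy'
    simp only [Z, mem_filter] at hi hj
    obtain ⟨h1, h2, h3, h4⟩ := hW hi.1
    obtain ⟨h1', h2', h3', h4'⟩ := hW hj.1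
    have hr := h.replace hv h1 hi.2.1 hi.2.2
    refine (hr.inner_disjoint (v := a i) hmax hcyc ?_ h2' h1' ?_ ?_ (hNB hy).1 ?_).1 (hNB hy).2
    · intro x hx
      by_cases hxi : x = i
      · simpa [hxi] using (hv i h1.le).symm
      · rw [Function.update_of_ne hxi]
        exact fun e => hxi (h.inj_left _ _ hx h1.le e)
    · rwa [Function.update_of_ne (by omega)]
    · rwa [Function.update_of_ne (by omega)]
    · rw [Function.update_of_ne hij.symm]
      exact (hNB hy').2)
  have hZsum : ∑ i ∈ Z, p (a i) ≤ #Z * p v := by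
    rw [← smul_eq_mul]
    exact sum_le_card_nsmul _ _ _ fun i hi => hpW i (hZW hi)
  obtain ⟨z, hz⟩ : ∃ z, #Z = z + 1 := ⟨#Z - 1, by omega⟩
  rw [hz] at hZ hZsum hZcard
  have h1 : z * p v ≤ z * s := Nat.mul_le_mul_left _ hv0
  have h2 : (z + 2) * (s + 2) ≤ (z + 2) * k := Nat.mul_le_mul_left _ hs
  nlinarith

/-- Either some path meets `ℓ` vertices of the first class, or the graph is a disjoint union of
two complete bipartite graphs whose second classes have equal size. -/
theorem exists_altPath_or_split [Fintype α] [Fintype β] {E : α → β → Prop} {k ℓ : ℕ}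
    (hk : ∀ x, k ≤ {y | E x y}.ncard) (hn : Fintype.card β ≤ 2 * k) (hℓk : ℓ + 1 ≤ k)
    (hℓ : ℓ + 1 ≤ Fintype.card α) :
    (∃ a b, IsAltPath E ℓ a b) ∨ ∃ (M₁ : Set α) (N₁ : Set β), M₁.Nonempty ∧ M₁ᶜ.Nonempty ∧
      N₁.ncard = k ∧ N₁ᶜ.ncard = k ∧ (∀ x ∈ M₁, {y | E x y} = N₁) ∧
      ∀ x ∉ M₁, {y | E x y} = N₁ᶜ := by
  classical
  rw [or_iff_not_imp_left]
  intro hno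
  obtain ⟨x₀⟩ : Nonempty α := Fintype.card_pos_iff.1 (by omega)
  obtain ⟨y₀, -⟩ : {y | E x₀ y}.Nonempty := by
    rw [← Set.ncard_pos]
    have := hk x₀
    omega
  obtain ⟨s, hsℓ, ⟨a, b, hab⟩, hmax⟩ : ∃ s < ℓ, (∃ a b, IsAltPath E s a b) ∧
      ∀ a b, ¬ IsAltPath E (s + 1) a b := by
    by_contra! hcon
    refine hno ?_
    have : ∀ s ≤ ℓ, ∃ a b, IsAltPath E s a b := by
      intro s
      induction s with
      | zero => exact fun _ => ⟨fun _ => x₀, fun _ => y₀, by constructor <;> intros <;> omega⟩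
      | succ s ih => exact fun hs => hcon s hs (ih (by omega))
    exact this ℓ le_rfl
  have hmiss : ∀ a : ℕ → α, ∃ v, ∀ i ≤ s, a i ≠ v := by
    intro a
    by_contra! hcon
    have : (univ : Finset α) ⊆ (range (s + 1)).image a := by
      intro v _
      obtain ⟨i, hi, rfl⟩ := hcon v
      exact mem_image_of_mem _ (mem_range.2 (by omega))
    have := (card_le_card this).trans card_image_le
    rw [card_univ, card_range] at this
    omega
  obtain ⟨a, b, hc⟩ : ∃ a b, IsAltCycle E s a b := by
    by_contra! hcyc
    have hgrow : ∀ m, ∃ a b v, IsAltPath E s a b ∧ (∀ i ≤ s, a i ≠ v) ∧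
        m ≤ #{y ∈ (range s).image b | E v y} := by
      intro m
      induction m with
      | zero =>
        obtain ⟨v, hv⟩ := hmiss a
        exact ⟨a, b, v, hab, hv, Nat.zero_le _⟩
      | succ m ih =>
        obtain ⟨a, b, v, hab, hv, hm⟩ := ih
        obtain ⟨a', b', v', hab', hv', hlt⟩ := exists_altPath_missing_more (k := k)
          (fun x => by simpa [Set.ncard_eq_toFinset_card'] using hk x) hn (by omega) hmax hcyc
          hab hv
        exact ⟨a', b', v', hab', hv', by omega⟩
    obtain ⟨a, b, v, -, -, hm⟩ := hgrow (s + 1)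
    have := hm.trans ((card_filter_le _ _).trans card_image_le)
    rw [card_range] at this
    omega
  have hcompl : ∀ v, (∀ i ≤ s, a i ≠ v) → ∀ i ≤ s, {y | E v y} = {y | E (a i) y}ᶜ ∧
      {y | E v y}.ncard = k ∧ {y | E (a i) y}.ncard = k := by
    intro v hv i hi
    have hsub : {y | E v y} ⊆ {y | E (a i) y}ᶜ := fun y hy => hc.not_common hmax hv hi hy
    have h1 := Set.ncard_add_ncard_compl {y | E (a i) y}
    rw [Nat.card_eq_fintype_card] at h1
    have h2 := hk v
    have h3 := hk (a i)
    have h4 := Set.ncard_le_ncard hsub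
    exact ⟨Set.eq_of_subset_of_ncard_le hsub (by omega), by omega, by omega⟩
  obtain ⟨v, hv⟩ := hmiss a
  refine ⟨{x | ∃ i ≤ s, a i = x}, {y | E v y}ᶜ, ⟨a 0, 0, by omega, rfl⟩,
    ⟨v, by simpa using hv⟩, ?_, ?_, ?_, ?_⟩
  · rw [(hcompl v hv 0 (by omega)).1, compl_compl]
    exact (hcompl v hv 0 (by omega)).2.2
  · rw [compl_compl]
    exact (hcompl v hv 0 (by omega)).2.1
  · rintro _ ⟨i, hi, rfl⟩
    rw [(hcompl v hv i hi).1, compl_compl]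
  · intro x hx
    have hx' : ∀ i ≤ s, a i ≠ x := by simpa using hx
    rw [compl_compl, (hcompl x hx' 0 (by omega)).1, (hcompl v hv 0 (by omega)).1]

end Counting

section PathEnds

variable {α β : Type*} {E : α → β → Prop}

/-- A path with both ends in the first class. -/
theorem IsAltPath.hasPathEndsIn_inl {s : ℕ} {a : ℕ → α} {b : ℕ → β} (h : IsAltPath E s a b) :
    HasPathEndsIn (biAdj E) (2 * s + 1) (Set.range Sum.inl) := by
  refine ⟨fun j => if j.val % 2 = 0 then Sum.inl (a (j.val / 2)) else Sum.inr (b (j.val / 2)),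
    ?_, ?_, ?_⟩
  · rintro ⟨i, hi⟩ ⟨j, hj⟩ e
    ext
    dsimp only at e ⊢
    split_ifs at e with h1 h2 h2
    · have := h.inj_left _ _ (by omega) (by omega) (Sum.inl_injective e)
      omega
    · have := h.inj_right _ _ (by omega) (by omega) (Sum.inr_injective e)
      omega
  · intro j hj
    rcases Nat.even_or_odd' j with ⟨i, rfl | rfl⟩
    · have := h.adj i (by omega)
      simpa [biAdj, show (2 * i + 1) / 2 = i by omega, Nat.add_mod] using this
    · have := h.adj_succ i (by omega)
      simpa [biAdj, show (2 * i + 1) / 2 = i by omega, Nat.add_mod,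
        show (2 * i + 1 + 1) / 2 = i + 1 by omega] using this
  · intro _
    simp

/-- A path with both ends in the second class. -/
theorem hasPathEndsIn_inr {s : ℕ} {a : ℕ → α} {b : ℕ → β}
    (hb : ∀ i j, i ≤ s → j ≤ s → b i = b j → i = j)
    (ha : ∀ i j, i < s → j < s → a i = a j → i = j)
    (h : ∀ i < s, E (a i) (b i) ∧ E (a i) (b (i + 1))) :
    HasPathEndsIn (biAdj E) (2 * s + 1) (Set.range Sum.inr) := by
  refine ⟨fun j => if j.val % 2 = 0 then Sum.inr (b (j.val / 2)) else Sum.inl (a (j.val / 2)),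
    ?_, ?_, ?_⟩
  · rintro ⟨i, hi⟩ ⟨j, hj⟩ e
    ext
    dsimp only at e ⊢
    split_ifs at e with h1 h2 h2
    · have := hb _ _ (by omega) (by omega) (Sum.inr_injective e)
      omega
    · have := ha _ _ (by omega) (by omega) (Sum.inl_injective e)
      omega
  · intro j hj
    rcases Nat.even_or_odd' j with ⟨i, rfl | rfl⟩
    · have := (h i (by omega)).1
      simpa [biAdj, show (2 * i + 1) / 2 = i by omega, Nat.add_mod] using this
    · have := (h i (by omega)).2
      simpa [biAdj, show (2 * i + 1) / 2 = i by omega, Nat.add_mod,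
        show (2 * i + 1 + 1) / 2 = i + 1 by omega] using this
  · intro _
    simp

theorem exists_enumeration {γ : Type*} [Finite γ] [Nonempty γ] {M : Set γ} {s : ℕ}
    (h : s ≤ M.ncard) :
    ∃ f : ℕ → γ, (∀ i j, i < s → j < s → f i = f j → i = j) ∧ ∀ i < s, f i ∈ M := by
  classical
  have := Fintype.ofFinite M
  obtain ⟨f⟩ : Nonempty (Fin s ↪ M) := by
    refine Function.Embedding.nonempty_of_card_le ?_
    rwa [Fintype.card_fin, ← Nat.card_eq_fintype_card, Nat.card_coe_set_eq]
  refine ⟨fun i => if h : i < s then f ⟨i, h⟩ else Classical.arbitrary γ, ?_, ?_⟩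
  · intro i j hi hj e
    simp only [hi, hj, dif_pos] at e
    simpa using f.injective (Subtype.ext e)
  · intro i hi
    simp only [hi, dif_pos]
    exact (f ⟨i, hi⟩).2

theorem hasPathEndsIn_inr_of_complete [Finite α] [Finite β] [Nonempty α] {M : Set α} {N : Set β}
    {s : ℕ} (hM : s ≤ M.ncard) (hN : s + 1 ≤ N.ncard) (h : ∀ x ∈ M, ∀ y ∈ N, E x y) :
    HasPathEndsIn (biAdj E) (2 * s + 1) (Set.range Sum.inr) := by
  have : Nonempty β := (Set.nonempty_of_ncard_ne_zero (s := N) (by omega)).to_type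
  obtain ⟨a, ha, haM⟩ := exists_enumeration hM
  obtain ⟨b, hb, hbN⟩ := exists_enumeration hN
  exact hasPathEndsIn_inr (fun i j hi hj => hb i j (by omega) (by omega)) ha fun i hi =>
    ⟨h _ (haM i hi) _ (hbN i (by omega)), h _ (haM i hi) _ (hbN (i + 1) (by omega))⟩

end PathEnds


/-- Corollary: let $G$ be bipartite with bipartition $\{M,N\}$, $|M| ≥ 2$, $|N| ≥ 3$,
$δ(M) ≥ |N|/2$, and let $ℓ = \min\{|M|, δ(M)\}$. Then $G$ has a path on $2ℓ-1$
vertices with both ends in $M$, or $M, N$ split as described. Moreover, if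
$|M| ≥ 2ℓ-3$ and $|N| = 2ℓ$, then $G$ has a path on $2ℓ-3$ vertices with both
ends in $N$. -/
theorem bipartite_path_or_split {α β : Type*} [Fintype α] [Fintype β]
    (E : α → β → Prop) (ℓ : ℕ)
    (hM : 2 ≤ Fintype.card α) (hN : 3 ≤ Fintype.card β)
    (hδ : ∀ a : α, Fintype.card β ≤ 2 * {b | E a b}.ncard)
    (hℓ : ℓ = min (Fintype.card α) (⨅ a : α, {b | E a b}.ncard)) :
    (HasPathEndsIn (biAdj E) (2 * ℓ - 1) (Set.range Sum.inl) ∨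
      ∃ (M₁ M₂ : Set α) (N₁ N₂ : Set β),
        M₁.Nonempty ∧ M₂.Nonempty ∧ N₁.Nonempty ∧ N₂.Nonempty ∧
        Disjoint M₁ M₂ ∧ Disjoint N₁ N₂ ∧
        M₁ ∪ M₂ = Set.univ ∧ N₁ ∪ N₂ = Set.univ ∧ N₁.ncard = N₂.ncard ∧
        (∀ a ∈ M₁, (∀ b ∈ N₁, E a b) ∧ ∀ b ∈ N₂, ¬ E a b) ∧
        (∀ a ∈ M₂, (∀ b ∈ N₂, E a b) ∧ ∀ b ∈ N₁, ¬ E a b)) ∧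
    (2 * ℓ - 3 ≤ Fintype.card α → Fintype.card β = 2 * ℓ →
      HasPathEndsIn (biAdj E) (2 * ℓ - 3) (Set.range Sum.inr)) := by

  have : Nonempty α := Fintype.card_pos_iff.1 (by omega)
  obtain ⟨x₀, hx₀⟩ := exists_eq_ciInf_of_finite (f := fun a : α => {b | E a b}.ncard)
  have hk : ∀ a, (⨅ a : α, {b | E a b}.ncard) ≤ {b | E a b}.ncard := fun a =>
    ciInf_le (OrderBot.bddBelow _) a
  have hn := hδ x₀
  rw [hx₀] at hn
  generalize (⨅ a : α, {b | E a b}.ncard) = k at hℓ hk hn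
  obtain ⟨s, rfl⟩ : ∃ s, ℓ = s + 2 := ⟨ℓ - 2, by omega⟩
  rcases exists_altPath_or_split (ℓ := s + 1) hk hn (by omega) (by omega) with
    ⟨a, b, h⟩ | ⟨M₁, N₁, hM₁, hM₂, hN₁, hN₂, h₁, h₂⟩
  · refine ⟨Or.inl h.hasPathEndsIn_inl, fun _ _ => ?_⟩
    refine hasPathEndsIn_inr (s := s) (a := fun i => a (i + 1)) (b := b) ?_ ?_ ?_
    · exact fun i j hi hj => h.inj_right i j (by omega) (by omega)
    · intro i j hi hj e
      have := h.inj_left _ _ (by omega) (by omega) e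
      omega
    · exact fun i hi => ⟨h.adj_succ i (by omega), h.adj (i + 1) (by omega)⟩
  · have hE₁ : ∀ x ∈ M₁, ∀ y, E x y ↔ y ∈ N₁ := fun x hx y => Set.ext_iff.1 (h₁ x hx) y
    have hE₂ : ∀ x ∉ M₁, ∀ y, E x y ↔ y ∉ N₁ := fun x hx y => Set.ext_iff.1 (h₂ x hx) y
    refine ⟨Or.inr ⟨M₁, M₁ᶜ, N₁, N₁ᶜ, hM₁, hM₂, Set.nonempty_of_ncard_ne_zero (by omega),
      Set.nonempty_of_ncard_ne_zero (by omega), disjoint_compl_right, disjoint_compl_right,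
      Set.union_compl_self _, Set.union_compl_self _, by omega, ?_, ?_⟩, fun hα _ => ?_⟩
    · exact fun x hx => ⟨fun y hy => (hE₁ x hx y).2 hy, fun y hy h => hy ((hE₁ x hx y).1 h)⟩
    · exact fun x hx => ⟨fun y hy => (hE₂ x hx y).2 hy, fun y hy h => (hE₂ x hx y).1 h hy⟩
    · have hcard := Set.ncard_add_ncard_compl M₁
      rw [Nat.card_eq_fintype_card] at hcard
      rcases le_or_gt s M₁.ncard with hs | hs
      · exact hasPathEndsIn_inr_of_complete (s := s) hs (by omega)
          fun x hx y hy => (hE₁ x hx y).2 hy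
      · exact hasPathEndsIn_inr_of_complete (s := s) (M := M₁ᶜ) (N := N₁ᶜ) (by omega) (by omega)
          fun x hx y hy => (hE₂ x hx y).2 hy
end

section
/- Let G be a bipartite graph with bipartition {M, N} such that |N| ≥ |M| ≥ 3 and δ(M) ≥ |N| − 1. If M contains at least two vertices each of which is adjacent to every vertex of N, then G contains a cycle of length 2|M|. -/
/-- A cyclic enumeration of one side together with distinct vertices of the other side joining
consecutive entries yields a cycle. -/
theorem hasCycleLen_biAdj_of_slots {α β : Type*} {E : α → β → Prop} {m : ℕ}
    {a : Fin m → α} {b : Fin m → β} (ha : Function.Injective a) (hb : Function.Injective b)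
    (h : ∀ i, E (a i) (b i) ∧ E (a (nextFin i)) (b i)) :
    HasCycleLen (biAdj E) (2 * m) := by
  have half_lt (j : Fin (2 * m)) : j.val / 2 < m := by omega
  refine ⟨fun j => if j.val % 2 = 0 then Sum.inl (a ⟨j.val / 2, half_lt j⟩)
    else Sum.inr (b ⟨j.val / 2, half_lt j⟩), fun j k hjk => ?_, fun j => ?_⟩
  · dsimp only at hjk
    split_ifs at hjk with hj hk hk
    · have := congrArg Fin.val (ha (Sum.inl.inj hjk))
      dsimp only at this
      omega
    · have := congrArg Fin.val (hb (Sum.inr.inj hjk))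
      dsimp only at this
      omega
  · have hnext : (nextFin j).val = (j.val + 1) % (2 * m) := rfl
    rcases Nat.mod_two_eq_zero_or_one j.val with hj | hj
    · have hval : (nextFin j).val = j.val + 1 := by
        rw [hnext, Nat.mod_eq_of_lt (by omega)]
      have hdiv : (j.val + 1) / 2 = j.val / 2 := by omega
      have hpar : ¬ (j.val + 1) % 2 = 0 := by omega
      simp only [hval, hj, hdiv, hpar, if_true, if_false]
      exact (h _).1
    · have hval : (nextFin j).val = 2 * ((j.val / 2 + 1) % m) := by
        rw [hnext, ← Nat.mul_mod_mul_left]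
        congr 1
        omega
      have hdiv : 2 * ((j.val / 2 + 1) % m) / 2 = (j.val / 2 + 1) % m := by omega
      have hpar : 2 * ((j.val / 2 + 1) % m) % 2 = 0 := by omega
      simp only [hval, hj, hdiv, hpar, if_true, one_ne_zero, if_false]
      exact (h ⟨j.val / 2, half_lt j⟩).2

/-- An equivalence with prescribed values at two distinct points. -/
theorem Equiv.exists_apply_eq_and_apply_eq {ι α : Type*} (e : ι ≃ α) {i j : ι} (hij : i ≠ j)
    {x y : α} (hxy : x ≠ y) : ∃ e' : ι ≃ α, e' i = x ∧ e' j = y := by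
  classical
  let e₁ := e.trans (Equiv.swap (e i) x)
  have hi : e₁ i = x := by simp [e₁]
  have hne : x ≠ e₁ j := fun h => hij (e₁.injective (hi.trans h))
  refine ⟨e₁.trans (Equiv.swap (e₁ j) y), ?_, ?_⟩
  · rw [Equiv.trans_apply, hi, Equiv.swap_apply_of_ne_of_ne hne hxy]
  · rw [Equiv.trans_apply, Equiv.swap_apply_left]

/-- Corollary: let $G$ be bipartite with bipartition $\{M,N\}$, $|N| ≥ |M| ≥ 3$ and
$δ(M) ≥ |N| - 1$. If $M$ has at least two vertices each adjacent to every vertex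
of $N$, then $G$ has a cycle of length $2|M|$. -/
theorem bipartite_hamiltonianish_cycle {α β : Type*} [Fintype α] [Fintype β]
    (E : α → β → Prop)
    (hM : 3 ≤ Fintype.card α) (hMN : Fintype.card α ≤ Fintype.card β)
    (hδ : ∀ a : α, Fintype.card β - 1 ≤ {b | E a b}.ncard)
    (h2 : ∃ a₁ a₂ : α, a₁ ≠ a₂ ∧ (∀ b, E a₁ b) ∧ ∀ b, E a₂ b) :
    HasCycleLen (biAdj E) (2 * Fintype.card α) := by
  classical
  obtain ⟨a₁, a₂, hne, h₁, h₂⟩ := h2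
  have hnon (a : α) : (Finset.univ.filter fun b => ¬ E a b).card ≤ 1 := by
    have hdeg := hδ a
    rw [show {b | E a b} = ↑(Finset.univ.filter fun b => E a b) by simp,
      Set.ncard_coe_finset] at hdeg
    have hsum := Finset.card_filter_add_card_filter_not (s := Finset.univ) (fun b => E a b)
    rw [Finset.card_univ] at hsum
    omega
  generalize hm : Fintype.card α = m at *
  let i₀ : Fin m := ⟨0, by omega⟩
  let i₁ : Fin m := ⟨1, by omega⟩
  have hi : i₀ ≠ i₁ := by simp [i₀, i₁]
  obtain ⟨e, he₀, he₁⟩ :=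
    (Fintype.equivFinOfCardEq hm).symm.exists_apply_eq_and_apply_eq hi hne
  have hnext : nextFin i₀ = i₁ := Fin.ext (Nat.mod_eq_of_lt (show 0 + 1 < m by omega))
  let t (i : Fin m) : Finset β :=
    Finset.univ.filter fun b => E (e i) b ∧ E (e (nextFin i)) b
  have ht (i : Fin m) : Fintype.card β ≤ (t i).card +
      ((Finset.univ.filter fun b => ¬ E (e i) b).card +
        (Finset.univ.filter fun b => ¬ E (e (nextFin i)) b).card) := by
    rw [← Finset.card_univ]
    refine le_trans (Finset.card_le_card fun b _ => ?_)
      ((Finset.card_union_le _ _).trans (Nat.add_le_add_left (Finset.card_union_le _ _) _))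
    simp only [t, Finset.mem_union, Finset.mem_filter, Finset.mem_univ, true_and]
    tauto
  have hfull {a : α} (ha : ∀ b, E a b) : (Finset.univ.filter fun b => ¬ E a b).card = 0 := by
    simp [ha]
  have hall : ∀ s : Finset (Fin m), s.card ≤ (s.biUnion t).card := by
    intro s
    have hsub {i : Fin m} (his : i ∈ s) : (t i).card ≤ (s.biUnion t).card :=
      Finset.card_le_card (Finset.subset_biUnion_of_mem t his)
    have hcompl := s.card_add_card_compl
    rw [Fintype.card_fin] at hcompl
    by_cases hs₀ : i₀ ∈ s
    · have := hsub hs₀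
      have := ht i₀
      rw [hnext, he₀, he₁, hfull h₁, hfull h₂] at this
      omega
    by_cases hs₁ : i₁ ∈ s
    · have := hsub hs₁
      have := ht i₁
      rw [he₁, hfull h₂] at this
      have := hnon (e (nextFin i₁))
      have : 0 < sᶜ.card := Finset.card_pos.2 ⟨i₀, Finset.mem_compl.2 hs₀⟩
      omega
    · rcases s.eq_empty_or_nonempty with rfl | ⟨i, his⟩
      · simp
      have := hsub his
      have := ht i
      have := hnon (e i)
      have := hnon (e (nextFin i))
      have : 1 < sᶜ.card :=
        Finset.one_lt_card.2 ⟨i₀, Finset.mem_compl.2 hs₀, i₁, Finset.mem_compl.2 hs₁, hi⟩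
      omega
  obtain ⟨b, hb, hbt⟩ := (Finset.all_card_le_biUnion_card_iff_exists_injective t).1 hall
  exact hasCycleLen_biAdj_of_slots e.injective hb fun i => (Finset.mem_filter.1 (hbt i)).2
end

section
/- Let G be a bipartite graph with bipartition {M, N} such that |M| ≥ 2 and |N| ≥ 4. If δ(M) > (|N| + 1)/2, or if Δ(M) > δ(M) = (|N| + 1)/2, then G has a cycle of length 2ℓ for every ℓ with 2 ≤ ℓ ≤ min{|M|, δ(M)}. -/
/-- There is an `R`-chain from `x` to `x'` which is a rearrangement of the list `T`. -/
def Linked {V : Type*} (R : V → V → Prop) (T : List V) (x x' : V) : Prop :=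
  ∃ l : List V, l.Perm T ∧ l.IsChain R ∧ l.head? = some x ∧ l.getLast? = some x'

section
variable {V : Type*} {R : V → V → Prop}

theorem isChain_reverse_of_symm (hR : ∀ a b, R a b → R b a) (l : List V) :
    l.reverse.IsChain R ↔ l.IsChain R := by
  rw [List.isChain_reverse]
  exact ⟨fun h => h.imp fun a b => hR b a, fun h => h.imp fun a b => hR a b⟩

/-- The list `l`, bordered by `a` and `b`, is an `R`-chain. -/
def IsSegment (R : V → V → Prop) (a : V) (l : List V) (b : V) : Prop :=
  (a :: l ++ [b]).IsChain R

theorem isSegment_nil {a b : V} : IsSegment R a [] b ↔ R a b := by simp [IsSegment]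

theorem isSegment_cons {a b c : V} {l : List V} :
    IsSegment R a (c :: l) b ↔ R a c ∧ IsSegment R c l b := by simp [IsSegment]

theorem isSegment_append_cons {a b c : V} {l₁ l₂ : List V} :
    IsSegment R a (l₁ ++ c :: l₂) b ↔ IsSegment R a l₁ c ∧ IsSegment R c l₂ b := by
  simpa [IsSegment] using List.isChain_split (R := R) (c := c) (l₁ := a :: l₁) (l₂ := l₂ ++ [b])

theorem isSegment_reverse (hR : ∀ a b, R a b → R b a) {a b : V} {l : List V} :
    IsSegment R a l.reverse b ↔ IsSegment R b l a := by
  rw [IsSegment, IsSegment, ← isChain_reverse_of_symm hR]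
  simp

theorem Linked.symm (hR : ∀ a b, R a b → R b a) {T : List V} {x x' : V}
    (h : Linked R T x x') : Linked R T x' x := by
  obtain ⟨l, h1, h2, h3, h4⟩ := h
  exact ⟨l.reverse, (List.reverse_perm l).trans h1, (isChain_reverse_of_symm hR l).2 h2,
    by simpa, by simpa⟩

theorem linked_of_perm_count {T : List V} {x x' : V} (l : List V)
    (h₁ : ∀ [DecidableEq V] (a : V), (x :: l ++ [x']).count a = T.count a)
    (h₂ : IsSegment R x l x') : Linked R T x x' := by
  classical
  exact ⟨x :: l ++ [x'], List.perm_iff_count.2 h₁, h₂, rfl, List.getLast?_concat ..⟩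

variable {u y₀ : V}

theorem linked_start_last (hu : R u y₀) {l : List V} {q : V}
    (hl : IsSegment R y₀ (l ++ [q]) y₀) :
    Linked R (u :: y₀ :: (l ++ [q])) u q := by
  refine linked_of_perm_count (y₀ :: l) ?_ ?_
  · simp only [List.count_append, List.count_cons, List.count_nil]; intros; omega
  · simp only [isSegment_append_cons, isSegment_cons, isSegment_nil] at hl ⊢
    grind

theorem linked_start_pred {l₁ l₂ : List V} {x y : V}
    (hl : IsSegment R y₀ (l₁ ++ x :: y :: l₂) y₀) (huy : R u y) :
    Linked R (u :: y₀ :: (l₁ ++ x :: y :: l₂)) u x := by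
  refine linked_of_perm_count (y :: l₂ ++ y₀ :: l₁) ?_ ?_
  · simp only [List.count_append, List.count_cons, List.count_nil]; intros; omega
  · simp only [List.cons_append, isSegment_append_cons, isSegment_cons] at hl ⊢
    grind

theorem linked_last_pred (hR : ∀ a b, R a b → R b a) (hu : R u y₀) {l₁ l₂ : List V} {x y q : V}
    (hl : IsSegment R y₀ (l₁ ++ x :: y :: (l₂ ++ [q])) y₀) (huy : R u y) :
    Linked R (u :: y₀ :: (l₁ ++ x :: y :: (l₂ ++ [q]))) q x := by
  refine .symm hR <| linked_of_perm_count (l₁.reverse ++ y₀ :: u :: y :: l₂) ?_ ?_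
  · simp only [List.count_append, List.count_cons, List.count_reverse, List.count_nil]
    intros; omega
  · simp only [isSegment_append_cons, isSegment_cons,
      isSegment_nil, isSegment_reverse hR] at hl ⊢
    grind

theorem linked_pred_pred (hR : ∀ a b, R a b → R b a) {l₁ l₂ l₃ : List V} {x y x₂ z : V}
    (hl : IsSegment R y₀ (l₁ ++ x :: y :: (l₂ ++ x₂ :: z :: l₃)) y₀)
    (huy : R u y) (huz : R u z) :
    Linked R (u :: y₀ :: (l₁ ++ x :: y :: (l₂ ++ x₂ :: z :: l₃))) x x₂ := by
  refine linked_of_perm_count (l₁.reverse ++ y₀ :: l₃.reverse ++ z :: u :: y :: l₂) ?_ ?_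
  · simp only [List.count_append, List.count_cons, List.count_reverse, List.count_nil]
    intros; omega
  · simp only [List.append_assoc, List.cons_append, isSegment_append_cons, isSegment_cons,
      isSegment_reverse hR] at hl ⊢
    grind

theorem linked_start_head (hR : ∀ a b, R a b → R b a) (hu : R u y₀) {v : V} {l : List V}
    (hl : IsSegment R y₀ (v :: l) y₀) :
    Linked R (u :: y₀ :: (v :: l)) u v := by
  refine linked_of_perm_count (y₀ :: l.reverse) ?_ ?_
  · simp only [List.count_append, List.count_cons, List.count_reverse, List.count_nil]
    intros; omega
  · simp only [isSegment_cons, isSegment_reverse hR] at hl ⊢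
    grind

theorem linked_start_of_last_adj (hR : ∀ a b, R a b → R b a) (hu : R u y₀)
    {y v q : V} {l₁ l₂ : List V}
    (hl : IsSegment R y₀ (l₁ ++ y :: v :: (l₂ ++ [q])) y₀) (hq : R q y) :
    Linked R (u :: y₀ :: (l₁ ++ y :: v :: (l₂ ++ [q]))) u v := by
  refine linked_of_perm_count (y₀ :: l₁ ++ y :: q :: l₂.reverse) ?_ ?_
  · simp only [List.count_append, List.count_cons, List.count_reverse, List.count_nil]
    intros; omega
  · simp only [List.cons_append, isSegment_append_cons, isSegment_cons,
      isSegment_nil, isSegment_reverse hR] at hl ⊢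
    grind

theorem linked_pred_before (hR : ∀ a b, R a b → R b a) (hu : R u y₀)
    {y' v q x y : V} {l₁ l₂ l₃ : List V}
    (hl : IsSegment R y₀ (l₁ ++ v :: y' :: (l₂ ++ x :: y :: (l₃ ++ [q]))) y₀)
    (hq : R q y') (huy : R u y) :
    Linked R (u :: y₀ :: (l₁ ++ v :: y' :: (l₂ ++ x :: y :: (l₃ ++ [q])))) v x := by
  refine .symm hR <| linked_of_perm_count
    (l₂.reverse ++ y' :: q :: l₃.reverse ++ y :: u :: y₀ :: l₁) ?_ ?_
  · simp only [List.count_append, List.count_cons, List.count_reverse, List.count_nil]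
    intros; omega
  · simp only [List.append_assoc, List.cons_append, isSegment_append_cons, isSegment_cons,
      isSegment_nil, isSegment_reverse hR] at hl ⊢
    grind

theorem linked_pred_succ (hR : ∀ a b, R a b → R b a) (hu : R u y₀) {v q x y : V} {l₁ l₂ : List V}
    (hl : IsSegment R y₀ (l₁ ++ x :: y :: v :: (l₂ ++ [q])) y₀)
    (hq : R q y) (huy : R u y) :
    Linked R (u :: y₀ :: (l₁ ++ x :: y :: v :: (l₂ ++ [q]))) v x := by
  refine linked_of_perm_count (l₂ ++ q :: y :: u :: y₀ :: l₁) ?_ ?_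
  · simp only [List.count_append, List.count_cons, List.count_nil]
    intros; omega
  · simp only [isSegment_append_cons, isSegment_cons, isSegment_nil] at hl ⊢
    grind

theorem linked_pred_after (hR : ∀ a b, R a b → R b a) (hu : R u y₀)
    {y' v q x y : V} {l₁ l₂ l₃ : List V}
    (hl : IsSegment R y₀ (l₁ ++ x :: y :: (l₂ ++ y' :: v :: (l₃ ++ [q]))) y₀)
    (hq : R q y') (huy : R u y) :
    Linked R (u :: y₀ :: (l₁ ++ x :: y :: (l₂ ++ y' :: v :: (l₃ ++ [q])))) v x := by
  refine .symm hR <| linked_of_perm_count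
    (l₁.reverse ++ y₀ :: u :: y :: l₂ ++ y' :: q :: l₃.reverse) ?_ ?_
  · simp only [List.count_append, List.count_cons, List.count_reverse, List.count_nil]
    intros; omega
  · simp only [List.append_assoc, List.cons_append, isSegment_append_cons, isSegment_cons,
      isSegment_nil, isSegment_reverse hR] at hl ⊢
    grind
end

theorem Finset.card_pred_add_le_of_pairwise_disjoint {ι β : Type*} [DecidableEq ι] [DecidableEq β]
    {O U X : Finset β} {D : Finset ι} {G : ι → Finset β} {i₀ : ι} (hi₀ : i₀ ∈ D)
    (hU : U ⊆ O) (hX : X ⊆ O) (hG : ∀ i ∈ D, G i ⊆ O) (hne : ∀ i ∈ D, (G i).Nonempty)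
    (hUX : Disjoint U X) (hUG : ∀ i ∈ D, Disjoint U (G i))
    (hXG : ∀ i ∈ D, i ≠ i₀ → Disjoint X (G i))
    (hGG : ∀ i ∈ D, ∀ j ∈ D, i ≠ j → Disjoint (G i) (G j)) :
    U.card + X.card + D.card ≤ O.card + 1 := by
  have h1 : (D.erase i₀).card ≤ ((D.erase i₀).biUnion G).card := by
    rw [Finset.card_biUnion fun i hi j hj hij =>
      hGG i (Finset.mem_of_mem_erase hi) j (Finset.mem_of_mem_erase hj) hij]
    simpa using Finset.card_nsmul_le_sum (D.erase i₀) (fun i => (G i).card) 1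
      fun i hi => Finset.card_pos.2 (hne i (Finset.mem_of_mem_erase hi))
  have h2 : Disjoint (U ∪ X) ((D.erase i₀).biUnion G) := by
    rw [Finset.disjoint_biUnion_right]
    intro i hi
    have hi' := Finset.mem_erase.1 hi
    exact Finset.disjoint_union_left.2 ⟨hUG i hi'.2, hXG i hi'.2 hi'.1⟩
  have h3 : (U ∪ X) ∪ (D.erase i₀).biUnion G ⊆ O := by
    refine Finset.union_subset (Finset.union_subset hU hX) (Finset.biUnion_subset.2 ?_)
    exact fun i hi => hG i (Finset.mem_of_mem_erase hi)
  have h4 := Finset.card_le_card h3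
  rw [Finset.card_union_of_disjoint h2, Finset.card_union_of_disjoint hUX] at h4
  have h5 := Finset.card_erase_add_one hi₀
  omega

section
variable {α β : Type*} {E : α → β → Prop}

theorem biAdj_symm (x y : α ⊕ β) (h : biAdj E x y) : biAdj E y x := by
  rcases x with a | b <;> rcases y with a' | b' <;> exact h

theorem biAdj_inl_inr {a : α} {b : β} (h : E a b) : biAdj E (.inl a) (.inr b) := h

theorem exists_inl_of_biAdj_inr {x : α ⊕ β} {b : β} (h : biAdj E x (.inr b)) :
    ∃ a, x = .inl a ∧ E a b := by
  rcases x with a | b' <;> simp_all [biAdj]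

theorem exists_inr_of_biAdj_inl {x : α ⊕ β} {a : α} (h : biAdj E x (.inl a)) :
    ∃ b, x = .inr b ∧ E a b := by
  rcases x with a' | b <;> simp_all [biAdj]

/-- The list `inr y :: l` is a cyclic sequence of distinct vertices, consecutive ones being
adjacent, which visits exactly the vertices of `S` and of `B`, two sets of the same size. -/
structure IsCycleOn (E : α → β → Prop) (S : Finset α) (B : Finset β) (y : β)
    (l : List (α ⊕ β)) : Prop where
  nodup : (Sum.inr y :: l).Nodup
  segment : IsSegment (biAdj E) (.inr y) l (.inr y)
  mem_left : ∀ a, .inl a ∈ l ↔ a ∈ S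
  mem_right : ∀ b, b ∈ B ↔ b = y ∨ .inr b ∈ l
  card_eq : B.card = S.card

variable {S : Finset α} {B : Finset β} {y : β} {l : List (α ⊕ β)}

theorem IsCycleOn.rotate {l₁ l₂ : List (α ⊕ β)} {z : β}
    (h : IsCycleOn E S B y (l₁ ++ .inr z :: l₂)) : IsCycleOn E S B z (l₂ ++ .inr y :: l₁) where
  nodup := by
    refine (List.Perm.nodup_iff ?_).1 h.nodup
    exact (List.perm_append_comm (l₁ := .inr y :: l₁) (l₂ := .inr z :: l₂))
  segment := by
    have := h.segment
    rw [isSegment_append_cons] at this ⊢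
    exact this.symm
  mem_left a := by
    rw [← h.mem_left]
    simp [or_comm]
  mem_right b := by
    rw [h.mem_right]
    simp
    tauto
  card_eq := h.card_eq

theorem IsCycleOn.exists_rotate_right (h : IsCycleOn E S B y l) {z : β} (hz : z ∈ B) :
    ∃ l', IsCycleOn E S B z l' := by
  rcases (h.mem_right z).1 hz with rfl | hz
  · exact ⟨l, h⟩
  · obtain ⟨l₁, l₂, rfl⟩ := List.append_of_mem hz
    exact ⟨_, h.rotate⟩

theorem IsCycleOn.exists_rotate_left (h : IsCycleOn E S B y l) {v : α} (hv : v ∈ S) :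
    ∃ z l', IsCycleOn E S B z (.inl v :: l') := by
  obtain ⟨l₁, l₂, rfl⟩ := List.append_of_mem ((h.mem_left v).2 hv)
  rcases List.eq_nil_or_concat l₁ with rfl | ⟨l₁, x, rfl⟩
  · exact ⟨y, l₂, h⟩
  · have hx : biAdj E x (.inl v) := by
      have := h.segment
      simp only [List.append_assoc, List.cons_append, List.concat_eq_append, isSegment_append_cons,
        isSegment_nil] at this
      exact this.2.1
    obtain ⟨b, rfl, -⟩ := exists_inr_of_biAdj_inl hx
    have h' : IsCycleOn E S B y (l₁ ++ .inr b :: (.inl v :: l₂)) := by simpa using h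
    exact ⟨b, l₂ ++ .inr y :: l₁, h'.rotate⟩

theorem IsCycleOn.exists_eq_concat (h : IsCycleOn E S B y l) {v : α} (hv : v ∈ S) :
    ∃ l' q, l = l' ++ [.inl q] := by
  rcases List.eq_nil_or_concat l with rfl | ⟨l', x, rfl⟩
  · simpa using (h.mem_left v).2 hv
  · have := h.segment
    simp only [List.concat_eq_append, isSegment_append_cons, isSegment_nil] at this
    obtain ⟨q, rfl, -⟩ := exists_inl_of_biAdj_inr this.2
    exact ⟨l', q, by simp⟩

theorem IsCycleOn.exists_pred (h : IsCycleOn E S B y l) {z : β} (hz : z ∈ B) (hzy : z ≠ y) :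
    ∃ x l₁ l₂, l = l₁ ++ .inl x :: .inr z :: l₂ := by
  obtain ⟨l₁, l₂, rfl⟩ := List.append_of_mem (((h.mem_right z).1 hz).resolve_left hzy)
  rcases List.eq_nil_or_concat l₁ with rfl | ⟨l₁, x, rfl⟩
  · simpa [biAdj, isSegment_cons] using h.segment
  · have := h.segment
    simp only [List.append_assoc, List.cons_append, List.concat_eq_append, isSegment_append_cons,
      isSegment_nil] at this
    obtain ⟨q, rfl, -⟩ := exists_inl_of_biAdj_inr this.2.1
    exact ⟨q, l₁, l₂, by simp⟩

theorem IsCycleOn.hasCycleLen (h : IsCycleOn E S B y l) :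
    HasCycleLen (biAdj E) (2 * S.card) := by
  classical
  have hlen : (Sum.inr y :: l).length = 2 * S.card := by
    have : (Sum.inr y :: l).toFinset = S.disjSum B := by
      ext x
      rcases x with a | b
      · simp [h.mem_left]
      · simp [h.mem_right]
    rw [← List.toFinset_card_of_nodup h.nodup, this, Finset.card_disjSum, h.card_eq, two_mul]
  rw [← hlen]
  refine ⟨(Sum.inr y :: l).get, List.nodup_iff_injective_get.1 h.nodup, fun j => ?_⟩
  have hs := h.segment
  rw [IsSegment, List.isChain_iff_getElem] at hs
  have hj := j.2
  have h1 := hs j (by simp at hj ⊢; omega)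
  rw [List.getElem_append_left hj] at h1
  rcases Nat.lt_or_ge (j + 1) (Sum.inr y :: l).length with hlt | hge
  · rw [List.getElem_append_left hlt] at h1
    have h0 : nextFin j = ⟨j + 1, hlt⟩ := Fin.ext (Nat.mod_eq_of_lt hlt)
    rw [h0]
    simpa using h1
  · have hj' : (j : ℕ) + 1 = (Sum.inr y :: l).length := by omega
    rw [List.getElem_append_right hge] at h1
    have h0 : nextFin j = ⟨0, by simp⟩ := Fin.ext (by simp [nextFin, hj'])
    rw [h0]
    simpa using h1

theorem IsCycleOn.linked_start_of_last_adj_all {u v q : α} {l' : List (α ⊕ β)}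
    (h : IsCycleOn E S B y (l' ++ [.inl q])) (huy : E u y) (hv : v ∈ S) (hvq : v ≠ q)
    (hq : ∀ b ∈ B, E q b) :
    Linked (biAdj E) (.inl u :: .inr y :: (l' ++ [.inl q])) (.inl u) (.inl v) := by
  have hs := h.segment
  have hvl : .inl v ∈ l' := by simpa [hvq] using (h.mem_left v).2 hv
  obtain ⟨l₁, l₂, rfl⟩ := List.append_of_mem hvl
  rcases List.eq_nil_or_concat l₁ with rfl | ⟨l₁, x, rfl⟩
  · exact linked_start_head biAdj_symm (biAdj_inl_inr huy) (by simpa using hs)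
  · have hx : biAdj E x (.inl v) := by
      simp only [List.append_assoc, List.cons_append, List.concat_eq_append,
        isSegment_append_cons, isSegment_nil] at hs
      exact hs.2.1
    obtain ⟨b, rfl, -⟩ := exists_inr_of_biAdj_inl hx
    have hb : b ∈ B := (h.mem_right b).2 (.inr (by simp))
    simp only [List.append_assoc, List.cons_append, List.concat_eq_append, List.nil_append]
      at hs ⊢
    exact linked_start_of_last_adj biAdj_symm (biAdj_inl_inr huy) hs (biAdj_inl_inr (hq b hb))

theorem IsCycleOn.linked_pred_of_last_adj_all {u v q x : α} {z : β} {l' l₁ l₂ : List (α ⊕ β)}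
    (h : IsCycleOn E S B y (l' ++ [.inl q])) (huy : E u y) (huz : E u z)
    (hl : l' ++ [.inl q] = l₁ ++ .inl x :: .inr z :: l₂)
    (hv : v ∈ S) (hvq : v ≠ q) (hvx : v ≠ x) (hq : ∀ b ∈ B, E q b) :
    Linked (biAdj E) (.inl u :: .inr y :: (l' ++ [.inl q])) (.inl v) (.inl x) := by
  rcases List.eq_nil_or_concat l₂ with rfl | ⟨l₂, w, rfl⟩
  · have := congrArg List.getLast? hl
    simp at this
  obtain ⟨rfl, rfl⟩ : l' = l₁ ++ .inl x :: .inr z :: l₂ ∧ .inl q = w := by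
    have : l' ++ [.inl q] = (l₁ ++ .inl x :: .inr z :: l₂) ++ [w] := by simpa using hl
    simpa using List.append_inj' this rfl
  have hs := h.segment
  have hvl := (h.mem_left v).2 hv
  simp [hvq, hvx] at hvl
  rcases hvl with hvl | hvl
  · obtain ⟨a₁, a₂, rfl⟩ := List.append_of_mem hvl
    rcases a₂ with _ | ⟨w, a₂⟩
    · simp [isSegment_append_cons, isSegment_cons, isSegment_nil, biAdj] at hs
    · have hw : biAdj E w (.inl v) := by
        simp only [List.append_assoc, List.cons_append, isSegment_append_cons, isSegment_cons]
          at hs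
        exact biAdj_symm _ _ hs.2.1
      obtain ⟨b, rfl, -⟩ := exists_inr_of_biAdj_inl hw
      have hb : b ∈ B := (h.mem_right b).2 (.inr (by simp))
      simp only [List.append_assoc, List.cons_append] at hs ⊢
      exact linked_pred_before biAdj_symm (biAdj_inl_inr huy) hs (biAdj_inl_inr (hq b hb))
        (biAdj_inl_inr huz)
  · obtain ⟨a₁, a₂, rfl⟩ := List.append_of_mem hvl
    rcases List.eq_nil_or_concat a₁ with rfl | ⟨a₁, w, rfl⟩
    · have hb : z ∈ B := (h.mem_right z).2 (.inr (by simp))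
      simp only [List.append_assoc, List.cons_append, List.nil_append] at hs ⊢
      exact linked_pred_succ biAdj_symm (biAdj_inl_inr huy) hs (biAdj_inl_inr (hq z hb))
        (biAdj_inl_inr huz)
    · have hw : biAdj E w (.inl v) := by
        simp only [List.append_assoc, List.cons_append, List.concat_eq_append,
          isSegment_append_cons, isSegment_cons, isSegment_nil] at hs
        exact hs.2.2.2.1
      obtain ⟨b, rfl, -⟩ := exists_inr_of_biAdj_inl hw
      have hb : b ∈ B := (h.mem_right b).2 (.inr (by simp))
      simp only [List.append_assoc, List.cons_append, List.concat_eq_append, List.nil_append]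
        at hs ⊢
      exact linked_pred_after biAdj_symm (biAdj_inl_inr huy) hs (biAdj_inl_inr (hq b hb))
        (biAdj_inl_inr huz)

theorem IsCycleOn.linked_preds {u x x₂ : α} {z z₂ : β} {l₁ l₂ m₁ m₂ : List (α ⊕ β)}
    (h : IsCycleOn E S B y l) (huz : E u z) (huz₂ : E u z₂) (hz : z ≠ z₂)
    (hl : l = l₁ ++ .inl x :: .inr z :: l₂) (hl₂ : l = m₁ ++ .inl x₂ :: .inr z₂ :: m₂) :
    Linked (biAdj E) (.inl u :: .inr y :: l) (.inl x) (.inl x₂) := by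
  wlog hle : l₁.length ≤ m₁.length generalizing x x₂ z z₂ l₁ l₂ m₁ m₂
  · exact (this huz₂ huz hz.symm hl₂ hl (by omega)).symm biAdj_symm
  have hs := h.segment
  rcases List.append_eq_append_iff.1 (hl.symm.trans hl₂) with ⟨a, ha, ha'⟩ | ⟨a, ha, ha'⟩
  · rcases a with _ | ⟨_, _ | ⟨_, a⟩⟩
    · simp at ha'
      exact absurd ha'.2.1 hz
    · simp at ha'
    · simp only [List.cons_append, List.cons.injEq] at ha'
      obtain ⟨rfl, rfl, rfl⟩ := ha'
      subst hl
      exact linked_pred_pred biAdj_symm hs (biAdj_inl_inr huz) (biAdj_inl_inr huz₂)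
  · have : a = [] := by
      rw [ha] at hle
      simpa using hle
    subst this
    simp at ha'
    exact absurd ha'.2.1.symm hz

variable [DecidableEq α] [DecidableEq β]

theorem IsCycleOn.of_linked {u x x' : α} {w : β} (h : IsCycleOn E S B y l) (hu : u ∉ S)
    (hw : w ∉ B) (hl : Linked (biAdj E) (.inl u :: .inr y :: l) (.inl x) (.inl x'))
    (hx : E x w) (hx' : E x' w) : ∃ l', IsCycleOn E (insert u S) (insert w B) w l' := by
  obtain ⟨c, hc, hchain, hhead, hlast⟩ := hl
  have hmem : ∀ z, z ∈ c ↔ z = .inl u ∨ z = .inr y ∨ z ∈ l := by simp [hc.mem_iff]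
  refine ⟨c, ?_, ?_, ?_, ?_, ?_⟩
  · rw [List.nodup_cons, hmem, hc.nodup_iff, List.nodup_cons]
    have h1 := h.mem_left u
    have h2 := h.mem_right w
    have h3 := h.nodup
    simp
    grind
  · rw [IsSegment, List.cons_append, List.isChain_cons, List.isChain_append]
    simp [hchain, hlast, hhead, biAdj, hx, hx']
  · intro a
    simp [hmem, h.mem_left]
  · intro b
    simp [hmem, h.mem_right]
  · have h2 := h.card_eq
    rw [Finset.card_insert_of_notMem hu, Finset.card_insert_of_notMem hw, h2]

theorem IsCycleOn.exists_insert_of_common {u v q : α} {w w' : β}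
    (h : IsCycleOn E S B y l) (hu : u ∉ S) (hv : l.head? = some (.inl v))
    (hq : l.getLast? = some (.inl q)) (hw : w ∉ B) (hw' : w' ∉ B) (hww : w ≠ w')
    (huw : E u w) (hvw : E v w) (huw' : E u w') (hqw' : E q w') :
    IsCycleOn E (insert u S) (insert w (insert w' (B.erase y))) w
      (l ++ [.inr w', .inl u]) where
  nodup := by
    have h1 := h.mem_left u
    have h2 := h.mem_right w
    have h2' := h.mem_right w'
    have h3 := h.nodup
    simp [List.nodup_append]
    grind
  segment := by
    have hs := h.segment
    rw [IsSegment, List.cons_append, List.isChain_cons, List.isChain_append] at hs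
    simp [IsSegment, List.isChain_cons, List.isChain_append, biAdj, *]
  mem_left a := by simp [h.mem_left, or_comm]
  mem_right b := by
    have := h.mem_right b
    have h3 := (List.nodup_cons.1 h.nodup).1
    simp
    grind
  card_eq := by
    have hy : y ∈ B := (h.mem_right y).2 (.inl rfl)
    rw [Finset.card_insert_of_notMem hu, Finset.card_insert_of_notMem (by simp [hww, hw]),
      Finset.card_insert_of_notMem (by simp [hw']), Finset.card_erase_add_one hy, h.card_eq]

variable [Fintype β]

/-- If the cycle visits `S` and `v ∈ S`, then it can be enlarged to visit one more vertex `u`. -/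
theorem IsCycleOn.exists_insert [DecidableRel E] {k : ℕ} {u v : α} (h : IsCycleOn E S B y l)
    (hu : u ∉ S) (hv : v ∈ S) (hk : S.card < k)
    (hdeg : ∀ a, k ≤ (Finset.univ.filter (E a)).card) (hcard : Fintype.card β + 1 ≤ 2 * k)
    (hvdeg : Fintype.card β + 2 ≤ k + (Finset.univ.filter (E v)).card) :
    ∃ B' y' l', IsCycleOn E (insert u S) B' y' l' := by
  by_contra hno
  set out : α → Finset β := fun a => Bᶜ.filter (E a) with hout
  have hmem : ∀ a b, b ∈ out a ↔ b ∉ B ∧ E a b := by simp [hout]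
  have hsplit : ∀ a, (B.filter (E a)).card + (out a).card = (Finset.univ.filter (E a)).card := by
    intro a
    rw [hout, ← Finset.card_union_of_disjoint, ← Finset.filter_union, Finset.union_compl]
    exact Finset.disjoint_filter_filter disjoint_compl_right
  have hinner : ∀ a, (B.filter (E a)).card ≤ S.card := fun a =>
    (Finset.card_filter_le _ _).trans_eq h.card_eq
  have hcompl : Bᶜ.card + S.card = Fintype.card β := by
    rw [← h.card_eq, Finset.card_compl_add_card]
  have hinter : ∀ a a', (out a).card + (out a').card ≤ Bᶜ.card + (out a ∩ out a').card := by
    intro a a'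
    rw [← Finset.card_union_add_card_inter]
    gcongr
    exact Finset.union_subset (Finset.filter_subset _ _) (Finset.filter_subset _ _)
  rcases (B.filter (E u)).eq_empty_or_nonempty with hD | ⟨y₀, hy₀⟩
  · obtain ⟨z, l, h⟩ := h.exists_rotate_left hv
    obtain ⟨l', q, hl⟩ := h.exists_eq_concat hv
    have hu' := hsplit u
    rw [hD, Finset.card_empty, zero_add] at hu'
    have h1 := hdeg u
    have h2 := hdeg q
    have h3 := hsplit v
    have h4 := hsplit q
    have h5 := hinner v
    have h6 := hinner q
    have h7 := hinter u v
    have h8 := hinter u q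
    obtain ⟨w', hw'⟩ : (out u ∩ out q).Nonempty := Finset.card_pos.1 (by omega)
    obtain ⟨w, hw, hww⟩ := Finset.exists_mem_ne (s := out u ∩ out v) (by omega) w'
    simp only [Finset.mem_inter, hmem] at hw hw'
    exact hno ⟨_, _, _, h.exists_insert_of_common (q := q) hu rfl (by rw [hl]; simp) hw.1.1
      hw'.1.1 hww hw.1.2 hw.2.2 hw'.1.2 hw'.2.2⟩
  · rw [Finset.mem_filter] at hy₀
    obtain ⟨l, h⟩ := h.exists_rotate_right hy₀.1
    obtain ⟨l', q, rfl⟩ := h.exists_eq_concat hv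
    obtain ⟨g, hg⟩ : ∃ g : β → α, ∀ z, z ∈ B → (z = y₀ ∧ g z = q) ∨
        (z ≠ y₀ ∧ ∃ l₁ l₂, l' ++ [.inl q] = l₁ ++ .inl (g z) :: .inr z :: l₂) := by
      refine Classical.skolem (p := fun z x => z ∈ B → (z = y₀ ∧ x = q) ∨ (z ≠ y₀ ∧
        ∃ l₁ l₂, l' ++ [.inl q] = l₁ ++ .inl x :: .inr z :: l₂)).1 fun z => ?_
      by_cases hzB : z ∈ B
      · by_cases hz : z = y₀
        · exact ⟨q, fun _ => .inl ⟨hz, rfl⟩⟩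
        · obtain ⟨x, hx⟩ := h.exists_pred hzB hz
          exact ⟨x, fun _ => .inr ⟨hz, hx⟩⟩
      · exact ⟨q, fun hz => absurd hz hzB⟩
    have hgy₀ : g y₀ = q := by
      rcases hg y₀ hy₀.1 with hh | hh
      · exact hh.2
      · exact absurd rfl hh.1
    have hdisj : ∀ {x x' : α}, Linked (biAdj E) (.inl u :: .inr y₀ :: (l' ++ [.inl q]))
        (.inl x) (.inl x') → Disjoint (out x) (out x') := by
      intro x x' hl
      rw [Finset.disjoint_left]
      intro w hw hw'
      rw [hmem] at hw hw'
      exact hno ⟨_, _, h.of_linked hu hw.1 hl hw.2 hw'.2⟩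
    have hlast_pred : ∀ {z x l₁ l₂}, E u z → l' ++ [.inl q] = l₁ ++ .inl x :: .inr z :: l₂ →
        Linked (biAdj E) (.inl u :: .inr y₀ :: (l' ++ [.inl q])) (.inl q) (.inl x) := by
      intro z x l₁ l₂ huz hl
      have hs := h.segment
      rcases List.eq_nil_or_concat l₂ with rfl | ⟨l₂, w, rfl⟩
      · have := congrArg List.getLast? hl
        simp at this
      · obtain ⟨rfl, rfl⟩ : l' = l₁ ++ .inl x :: .inr z :: l₂ ∧ .inl q = w := by
          have : l' ++ [.inl q] = (l₁ ++ .inl x :: .inr z :: l₂) ++ [w] := by simpa using hl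
          simpa using List.append_inj' this rfl
        simp only [List.append_assoc, List.cons_append] at hs ⊢
        exact linked_last_pred biAdj_symm (biAdj_inl_inr hy₀.2) hs (biAdj_inl_inr huz)
    have hUG : ∀ z ∈ B.filter (E u), Disjoint (out u) (out (g z)) := by
      intro z hz
      rw [Finset.mem_filter] at hz
      refine hdisj ?_
      have hs := h.segment
      rcases hg z hz.1 with ⟨-, hgz⟩ | ⟨-, l₁, l₂, hl⟩
      · rw [hgz]
        exact linked_start_last (biAdj_inl_inr hy₀.2) hs
      · rw [hl] at hs ⊢
        exact linked_start_pred hs (biAdj_inl_inr hz.2)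
    have hGG : ∀ z ∈ B.filter (E u), ∀ z' ∈ B.filter (E u), z ≠ z' →
        Disjoint (out (g z)) (out (g z')) := by
      intro z hz z' hz' hne
      rw [Finset.mem_filter] at hz hz'
      rcases hg z hz.1 with ⟨hz1, hgz⟩ | ⟨hz1, l₁, l₂, hl⟩ <;>
      rcases hg z' hz'.1 with ⟨hz1', hgz'⟩ | ⟨hz1', m₁, m₂, hl'⟩
      · exact absurd (hz1.trans hz1'.symm) hne
      · rw [hgz]
        exact hdisj (hlast_pred hz'.2 hl')
      · rw [hgz']
        exact (hdisj (hlast_pred hz.2 hl)).symm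
      · exact hdisj (h.linked_preds hz.2 hz'.2 hne hl hl')
    have hne : ∀ z ∈ B.filter (E u), (out (g z)).Nonempty := by
      intro z _
      have h1 := hdeg (g z)
      have h2 := hsplit (g z)
      have h3 := hinner (g z)
      exact Finset.card_pos.1 (by omega)
    have hsub : ∀ a, out a ⊆ Bᶜ := fun a => Finset.filter_subset _ _
    -- A large outer neighbourhood disjoint from almost all the others is impossible.
    have hlarge : ∀ x, ∀ z₀ ∈ B.filter (E u), Disjoint (out u) (out x) →
        (∀ z ∈ B.filter (E u), z ≠ z₀ → Disjoint (out x) (out (g z))) →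
        (out x).card + k + S.card < Fintype.card β + 2 := by
      intro x z₀ hz₀ hux hxg
      have h1 := Finset.card_pred_add_le_of_pairwise_disjoint hz₀ (hsub u) (hsub x)
        (fun z _ => hsub (g z)) hne hux hUG hxg hGG
      have h2 := hsplit u
      have h3 := hdeg u
      omega
    have hsmall : ∀ z ∈ B.filter (E u), (out (g z)).card + k + S.card < Fintype.card β + 2 :=
      fun z hz => hlarge (g z) z hz (hUG z hz) fun z' hz' hne => hGG z hz z' hz' hne.symm
    have hy₀' : y₀ ∈ B.filter (E u) := Finset.mem_filter.2 hy₀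
    have hvout : Fintype.card β + 2 ≤ (out v).card + k + S.card := by
      have h1 := hsplit v
      have h2 := hinner v
      omega
    have hvg : ∀ z ∈ B.filter (E u), v ≠ g z := by
      rintro z hz rfl
      exact absurd (hsmall z hz) (by omega)
    have hvq : v ≠ q := hgy₀ ▸ hvg y₀ hy₀'
    have hq : ∀ b ∈ B, E q b := by
      have h1 := hsmall y₀ hy₀'
      rw [hgy₀] at h1
      have h2 := hsplit q
      have h3 := hdeg q
      have h4 := h.card_eq
      refine Finset.filter_eq_self.1 (Finset.eq_of_subset_of_card_le (Finset.filter_subset _ _) ?_)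
      omega
    refine absurd (hlarge v y₀ hy₀' ?_ ?_) (by omega)
    · exact hdisj (h.linked_start_of_last_adj_all hy₀.2 hv hvq hq)
    · intro z hz hzy
      have hz' := Finset.mem_filter.1 hz
      obtain ⟨-, l₁, l₂, hl⟩ := (hg z hz'.1).resolve_left fun hh => hzy hh.1
      exact hdisj (h.linked_pred_of_last_adj_all hy₀.2 hz'.2 hl hv hvq (hvg z hz) hq)

theorem exists_isCycleOn [DecidableRel E] {k : ℕ} {v : α}
    (hdeg : ∀ a, k ≤ (Finset.univ.filter (E a)).card) (hcard : Fintype.card β + 1 ≤ 2 * k)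
    (hvdeg : Fintype.card β + 2 ≤ k + (Finset.univ.filter (E v)).card)
    (T : Finset α) (hvT : v ∉ T) (hT : T.card < k) :
    ∃ B y l, IsCycleOn E (insert v T) B y l := by
  induction T using Finset.induction_on with
  | empty =>
    obtain ⟨y, hy⟩ : (Finset.univ.filter (E v)).Nonempty :=
      Finset.card_pos.1 (by have := hdeg v; omega)
    have hy : E v y := by simpa using hy
    exact ⟨{y}, y, [.inl v], by simp, by simp [isSegment_cons, isSegment_nil, biAdj, hy],
      by simp, by simp, by simp⟩
  | insert u T hu ih =>
    rw [Finset.card_insert_of_notMem hu] at hT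
    rw [Finset.mem_insert, not_or] at hvT
    obtain ⟨B, y, l, h⟩ := ih hvT.2 (by omega)
    rw [Finset.insert_comm]
    refine h.exists_insert (v := v) ?_ (by simp) ?_ hdeg hcard hvdeg
    · simp [hu, Ne.symm hvT.1]
    · rw [Finset.card_insert_of_notMem hvT.2]
      omega
end

/-- Corollary: let $G$ be bipartite with bipartition $\{M,N\}$, $|M| ≥ 2$, $|N| ≥ 4$.
If $δ(M) > (|N|+1)/2$, or $Δ(M) > δ(M) = (|N|+1)/2$, then $G$ has a cycle of
length $2ℓ$ for every $2 ≤ ℓ ≤ \min\{|M|, δ(M)\}$. -/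
theorem bipartite_all_even_cycles {α β : Type*} [Fintype α] [Fintype β]
    (E : α → β → Prop)
    (hM : 2 ≤ Fintype.card α) (hN : 4 ≤ Fintype.card β)
    (hcond : (Fintype.card β + 1 < 2 * ⨅ a : α, {b | E a b}.ncard) ∨
      (2 * (⨅ a : α, {b | E a b}.ncard) = Fintype.card β + 1 ∧
        (⨅ a : α, {b | E a b}.ncard) < ⨆ a : α, {b | E a b}.ncard)) :
    ∀ ℓ : ℕ, 2 ≤ ℓ → ℓ ≤ Fintype.card α → ℓ ≤ (⨅ a : α, {b | E a b}.ncard) →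
      HasCycleLen (biAdj E) (2 * ℓ) := by
  classical
  intro ℓ hℓ hℓM hℓδ
  have hne : Nonempty α := Fintype.card_pos_iff.1 (by omega)
  have hncard : ∀ a, {b | E a b}.ncard = (Finset.univ.filter (E a)).card := by
    intro a
    rw [Set.ncard_eq_toFinset_card']
    congr 1
    ext b
    simp
  simp only [hncard] at hcond hℓδ
  set k := ⨅ a : α, (Finset.univ.filter (E a)).card with hk
  have hdeg : ∀ a, k ≤ (Finset.univ.filter (E a)).card := fun a => ciInf_le (OrderBot.bddBelow _) a
  obtain ⟨v, hv⟩ : ∃ v, Fintype.card β + 2 ≤ k + (Finset.univ.filter (E v)).card := by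
    rcases hcond with h | ⟨h, h'⟩
    · obtain ⟨v⟩ := hne
      exact ⟨v, by have := hdeg v; omega⟩
    · obtain ⟨v, hv⟩ := exists_eq_ciSup_of_finite (f := fun a => (Finset.univ.filter (E a)).card)
      rw [← hv] at h'
      exact ⟨v, by omega⟩
  obtain ⟨T, hvT, -, hT⟩ := Finset.exists_subsuperset_card_eq
    (Finset.subset_univ {v}) (by simp; omega) (hℓM.trans_eq Finset.card_univ.symm)
  have hvT : v ∈ T := by simpa using hvT
  have hT' := Finset.card_erase_add_one hvT
  obtain ⟨B, y, l, h⟩ := exists_isCycleOn hdeg (by omega) hv (T.erase v) (by simp) (by omega)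
  rw [Finset.insert_erase hvT] at h
  rw [← hT]
  exact h.hasCycleLen
end

section
/- Let n ≥ 3 and let (G, τ) be a Gallai-colored complete graph. If (G, τ) contains a monochromatic copy of the cycle C_{2n}, then (G, τ) contains a monochromatic copy of Θ_{2n}; that is, there is a cycle on 2n vertices together with a chord, all of whose 2n + 1 edges receive the same color. -/
/-- A symmetric edge coloring of the complete graph on `V`. -/
def ColorSymm {V γ : Type*} (c : V → V → γ) : Prop := ∀ u v, c u v = c v u

/-- A Gallai coloring: no triangle receives three distinct colors. -/
def IsGallai {V γ : Type*} (c : V → V → γ) : Prop :=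
  ∀ u v w : V, u ≠ v → v ≠ w → u ≠ w →
    c u v = c v w ∨ c u v = c u w ∨ c v w = c u w

/-- A monochromatic cycle on `m` vertices in color `i`. -/
def MonoCycle {V γ : Type*} (c : V → V → γ) (m : ℕ) (i : γ) : Prop :=
  ∃ f : Fin m → V, Function.Injective f ∧ ∀ j : Fin m, c (f j) (f (nextFin j)) = i

/-- A monochromatic copy of `Θ_m` in color `i`: a cycle on `m` vertices together with
a chord joining two non-consecutive vertices, all edges in color `i`. -/
def MonoTheta {V γ : Type*} (c : V → V → γ) (m : ℕ) (i : γ) : Prop :=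
  ∃ f : Fin m → V, Function.Injective f ∧
    (∀ j : Fin m, c (f j) (f (nextFin j)) = i) ∧
    ∃ a b : Fin m, a ≠ b ∧ b ≠ nextFin a ∧ a ≠ nextFin b ∧ c (f a) (f b) = i

/-- A monochromatic path on `m` vertices in color `i`. -/
def MonoPath {V γ : Type*} (c : V → V → γ) (m : ℕ) (i : γ) : Prop :=
  ∃ f : Fin m → V, Function.Injective f ∧
    ∀ (j : ℕ) (h : j + 1 < m), c (f ⟨j, by omega⟩) (f ⟨j + 1, h⟩) = i

/-- In a Gallai coloring, if consecutive terms of a sequence of vertices are joined in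
color `i` while all chords, of length from `2` to `m - 2`, avoid `i`, then all chords have the same
color. -/
theorem chord_color_eq {V γ : Type*} {c : V → V → γ} (hg : IsGallai c)
    {m : ℕ} (hm : 5 ≤ m) {i : γ} {F : ℕ → V}
    (hne : ∀ u t, 0 < t → t < m → F u ≠ F (u + t))
    (hcyc : ∀ u, c (F u) (F (u + 1)) = i)
    (hchord : ∀ u t, 2 ≤ t → t + 2 ≤ m → c (F u) (F (u + t)) ≠ i)
    (u t : ℕ) (ht : 2 ≤ t) (htm : t + 2 ≤ m) :
    c (F u) (F (u + t)) = c (F 0) (F 2) := by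
  have fan : ∀ u t, 2 ≤ t → t + 2 ≤ m → c (F u) (F (u + t)) = c (F u) (F (u + 2)) := by
    intro u t ht
    induction t, ht using Nat.le_induction with
    | base => intro _; rfl
    | succ t ht ih =>
      intro htm
      rw [← ih (by omega)]
      have h1 := hchord u t ht (by omega)
      have h2 := hchord u (t + 1) (by omega) htm
      have h3 := hcyc (u + t)
      rcases hg (F u) (F (u + t)) (F (u + t + 1)) (hne _ _ (by omega) (by omega))
        (hne _ _ (by omega) (by omega)) (hne u (t + 1) (by omega) (by omega)) with h | h | h
      · exact absurd (h.trans h3) h1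
      · exact h.symm
      · exact absurd (h.symm.trans h3) h2
  have shift : ∀ u, c (F (u + 1)) (F (u + 1 + 2)) = c (F u) (F (u + 2)) := by
    intro u
    rw [← fan u 3 (by omega) (by omega)]
    have h1 := hchord u 3 (by omega) (by omega)
    have h2 := hchord (u + 1) 2 (by omega) (by omega)
    have h3 := hcyc u
    rcases hg (F u) (F (u + 1)) (F (u + 1 + 2)) (hne _ _ (by omega) (by omega))
      (hne _ _ (by omega) (by omega)) (hne u 3 (by omega) (by omega)) with h | h | h
    · exact absurd (h.symm.trans h3) h2
    · exact absurd (h.symm.trans h3) h1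
    · exact h
  rw [fan u t ht htm]
  induction u with
  | zero => rfl
  | succ u ih => rw [shift, ih]

/-- A Hamiltonian cycle in the complement of the cycle `0, 1, …, 2 * n - 1`: the even indices in
increasing order, followed by `1`, followed by the other odd indices in decreasing order. -/
def complementCycle (n k : ℕ) : ℕ :=
  if k < n then 2 * k else if k = n then 1 else 4 * n + 1 - 2 * k

theorem complementCycle_lt {n k : ℕ} (hn : 3 ≤ n) (hk : k < 2 * n) :
    complementCycle n k < 2 * n := by
  unfold complementCycle
  split_ifs <;> omega

theorem complementCycle_inj {n k l : ℕ} (hk : k < 2 * n) (hl : l < 2 * n)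
    (h : complementCycle n k = complementCycle n l) : k = l := by
  unfold complementCycle at h
  split_ifs at h <;> omega

/-- In a Gallai-colored complete graph, a monochromatic $C_{2n}$ ($n ≥ 3$) forces a
monochromatic $Θ_{2n}$: a cycle on $2n$ vertices together with a chord, all of whose
$2n+1$ edges receive the same color. -/
theorem mono_theta_of_mono_cycle {V γ : Type*} (n : ℕ) (hn : 3 ≤ n)
    (c : V → V → γ) (hsym : ColorSymm c) (hg : IsGallai c)
    (h : ∃ i : γ, MonoCycle c (2 * n) i) :
    ∃ i : γ, MonoTheta c (2 * n) i := by
  obtain ⟨i, f, hf, hcyc⟩ := h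
  by_cases hred : ∃ a b : Fin (2 * n), a ≠ b ∧ b ≠ nextFin a ∧ a ≠ nextFin b ∧ c (f a) (f b) = i
  · exact ⟨i, f, hf, hcyc, hred⟩
  have hpos : 0 < 2 * n := by omega
  let F : ℕ → V := fun k => f ⟨k % (2 * n), Nat.mod_lt _ hpos⟩
  have hmod : ∀ u t : ℕ, u % (2 * n) = (u + t) % (2 * n) → 2 * n ∣ t := fun u t h =>
    Nat.modEq_zero_iff_dvd.1
      (Nat.ModEq.add_left_cancel' u (show u + t ≡ u + 0 [MOD 2 * n] from h.symm))
  have hnd : ∀ t, 0 < t → t < 2 * n → ¬ 2 * n ∣ t := fun t h0 h1 hd =>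
    absurd (Nat.le_of_dvd h0 hd) (by omega)
  have hne : ∀ u t, 0 < t → t < 2 * n → F u ≠ F (u + t) := by
    intro u t h0 h1 h
    exact hnd t h0 h1 (hmod u t (Fin.ext_iff.1 (hf h)))
  have hcycF : ∀ u, c (F u) (F (u + 1)) = i := by
    intro u
    have h := hcyc ⟨u % (2 * n), Nat.mod_lt _ hpos⟩
    simpa only [F, nextFin, Nat.mod_add_mod] using h
  have hchord : ∀ u t, 2 ≤ t → t + 2 ≤ 2 * n → c (F u) (F (u + t)) ≠ i := by
    intro u t h2 hm hi
    refine hred ⟨_, _, ?_, ?_, ?_, hi⟩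
    · intro h
      exact hnd t (by omega) (by omega) (hmod u t (Fin.ext_iff.1 h))
    · intro h
      have h' := Fin.ext_iff.1 h
      simp only [nextFin, Nat.mod_add_mod] at h'
      exact hnd (t - 1) (by omega) (by omega) (hmod (u + 1) (t - 1) (by
        rw [← h']; congr 1; omega))
    · intro h
      have h' := Fin.ext_iff.1 h
      simp only [nextFin, Nat.mod_add_mod] at h'
      exact hnd (t + 1) (by omega) (by omega) (hmod u (t + 1) h')
  have hper : ∀ u, F (u + 2 * n) = F u := fun u => by simp only [F, Nat.add_mod_right]
  have hblue := chord_color_eq hg (by omega) hne hcycF hchord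
  have hF : ∀ k (hk : k < 2 * n), f ⟨k, hk⟩ = F k := fun k hk => by
    simp only [F, Nat.mod_eq_of_lt hk]
  refine ⟨c (F 0) (F 2), fun k => f ⟨complementCycle n k, complementCycle_lt hn k.2⟩, ?_, ?_,
    ⟨0, hpos⟩, ⟨2, by omega⟩, ?_, ?_, ?_, ?_⟩
  · intro k l h
    exact Fin.ext (complementCycle_inj k.2 l.2 (Fin.ext_iff.1 (hf h)))
  · rintro ⟨k, hk⟩
    simp only [hF, nextFin]
    rcases Nat.lt_or_ge (k + 1) (2 * n) with hk1 | hk1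
    · rw [Nat.mod_eq_of_lt hk1]
      unfold complementCycle
      split_ifs
      · exact hblue (2 * k) 2 (by omega) (by omega)
      · rw [← hper 1, show 1 + 2 * n = 2 * k + 3 by omega]
        exact hblue (2 * k) 3 (by omega) (by omega)
      · omega
      · omega
      · omega
      · rw [← hper 1, hsym, show 1 + 2 * n = 4 * n + 1 - 2 * (k + 1) + 2 by omega]
        exact hblue _ 2 (by omega) (by omega)
      · omega
      · omega
      · rw [hsym, show 4 * n + 1 - 2 * k = 4 * n + 1 - 2 * (k + 1) + 2 by omega]
        exact hblue _ 2 (by omega) (by omega)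
    · obtain rfl : k = 2 * n - 1 := by omega
      rw [show 2 * n - 1 + 1 = 2 * n by omega, Nat.mod_self, hsym]
      have h0 : complementCycle n 0 = 0 := by unfold complementCycle; split_ifs <;> omega
      have h1 : complementCycle n (2 * n - 1) = 0 + 3 := by
        unfold complementCycle; split_ifs <;> omega
      rw [h0, h1]
      exact hblue 0 3 (by omega) (by omega)
  · simp
  · simp [nextFin, Nat.mod_eq_of_lt (show 1 < 2 * n by omega)]
  · simp [nextFin, Nat.mod_eq_of_lt (show 3 < 2 * n by omega)]
  · have h0 : complementCycle n 0 = 0 := by unfold complementCycle; split_ifs <;> omega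
    have h2 : complementCycle n 2 = 0 + 4 := by unfold complementCycle; split_ifs <;> omega
    simp only [hF, h0, h2]
    exact hblue 0 4 (by omega) (by omega)
end
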